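/- arXiv:math/0701730 — 4 statements merged into one kernel-verified Lean document; each statement's English description precedes it below -/
import Mathlib

section
/- Let (R, 𝔪) be a commutative Noetherian local ring and M a finitely generated R-module of dimension d. If there exists a good system of parameters of M having the property of parametric decomposition, then M is a sequentially Cohen-Macaulay module. -/
open IsLocalRing

/-- The Krull dimension of a module, `dim M = dim R/ann M`. -/
noncomputable def moduleDim (R : Type*) [CommRing R] (M : Type*) [AddCommGroup M]
    [Module R M] : WithBot ℕ∞ :=
  ringKrullDim (R ⧸ Module.annihilator R M)

/-- The length of a module, as the Krull dimension of its lattice of submodules. -/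
noncomputable def moduleLength (R : Type*) [CommRing R] (M : Type*) [AddCommGroup M]
    [Module R M] : WithBot ℕ∞ :=
  Order.krullDim (Submodule R M)

/-- The depth of a module over a local ring: the supremum of lengths of `M`-regular
sequences consisting of elements of the maximal ideal. -/
noncomputable def moduleDepth (R : Type*) [CommRing R] [IsLocalRing R] (M : Type*)
    [AddCommGroup M] [Module R M] : ℕ∞ :=
  sSup {n : ℕ∞ | ∃ rs : List R, (rs.length : ℕ∞) = n ∧ (∀ r ∈ rs, r ∈ maximalIdeal R) ∧
    RingTheory.Sequence.IsRegular M rs}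

/-- A module over a Noetherian local ring is Cohen-Macaulay if its depth equals its
Krull dimension. -/
def IsCM (R : Type*) [CommRing R] [IsLocalRing R] (M : Type*) [AddCommGroup M]
    [Module R M] : Prop :=
  (moduleDepth R M : WithBot ℕ∞) = moduleDim R M

/-- The zeroth local cohomology `H^0_𝔪(M)`: the submodule of elements annihilated by
some power of the maximal ideal. -/
noncomputable def H0m (R : Type*) [CommRing R] [IsLocalRing R] (M : Type*) [AddCommGroup M]
    [Module R M] : Submodule R M :=
  ⨆ n : ℕ, Submodule.torsionBySet R M ((maximalIdeal R ^ n : Ideal R) : Set R)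

/-- `x : Fin d → R` is a system of parameters of `M` (where `d = dim M`):
all `x i` lie in the maximal ideal and `M/(x₁,…,x_d)M` has finite length. -/
def IsSOP (R : Type*) [CommRing R] [IsLocalRing R] (M : Type*) [AddCommGroup M] [Module R M]
    {d : ℕ} (x : Fin d → R) : Prop :=
  (∀ i, x i ∈ maximalIdeal R) ∧
    IsFiniteLength R (M ⧸ (Ideal.span (Set.range x) • (⊤ : Submodule R M)))

/-- `Λ_{s,n}`: tuples of positive integers of size `s` summing to `s + n - 1`. -/
def Lambda (s n : ℕ) : Set (Fin s → ℕ) :=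
  {α | (∀ i, 1 ≤ α i) ∧ (∑ i, α i) = s + n - 1}

/-- The sequence `x` has the property of parametric decomposition:
`q^n M = ⋂_{α ∈ Λ_{d,n}} (x₁^{α₁},…,x_d^{α_d})M` for all `n ≥ 1`, where `q = (x₁,…,x_d)`. -/
def HasParamDecomp (R : Type*) [CommRing R] (M : Type*) [AddCommGroup M] [Module R M]
    {d : ℕ} (x : Fin d → R) : Prop :=
  ∀ n : ℕ, 1 ≤ n →
    (Ideal.span (Set.range x)) ^ n • (⊤ : Submodule R M) =
      ⨅ α ∈ Lambda d n, Ideal.span (Set.range fun i => x i ^ α i) • (⊤ : Submodule R M)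

/-- `D : Fin (t+1) → Submodule R M` is the dimension filtration of `M`:
`D 0 = H^0_𝔪(M)`, `D t = M`, and each `D i` is the largest submodule of `D (i+1)` of
strictly smaller dimension. -/
def IsDimFiltration (R : Type*) [CommRing R] [IsLocalRing R] (M : Type*) [AddCommGroup M]
    [Module R M] {t : ℕ} (D : Fin (t + 1) → Submodule R M) : Prop :=
  D 0 = H0m R M ∧ D (Fin.last t) = ⊤ ∧
    ∀ i : Fin t,
      D i.castSucc ≤ D i.succ ∧
      moduleDim R ↥(D i.castSucc) < moduleDim R ↥(D i.succ) ∧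
      ∀ N : Submodule R M, N ≤ D i.succ →
        moduleDim R ↥N < moduleDim R ↥(D i.succ) → N ≤ D i.castSucc

/-- Given the dimension filtration `D` with `d_i = ds i`, a system of parameters
`x₁,…,x_d` is good if `D_i ∩ (x_{d_i+1},…,x_d)M = 0` for all `i < t`. -/
def IsGoodSOP (R : Type*) [CommRing R] [IsLocalRing R] (M : Type*) [AddCommGroup M]
    [Module R M] {d t : ℕ} (D : Fin (t + 1) → Submodule R M) (ds : Fin (t + 1) → ℕ)
    (x : Fin d → R) : Prop :=
  IsSOP R M x ∧
    ∀ i : Fin (t + 1), (i : ℕ) < t →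
      D i ⊓ (Ideal.span {r : R | ∃ j : Fin d, ds i ≤ (j : ℕ) ∧ r = x j}) •
        (⊤ : Submodule R M) = ⊥


namespace PDec

/-- The monomial `x^γ`. -/
def mon {R : Type*} [CommRing R] {d : ℕ} (x : Fin d → R) (γ : Fin d → ℕ) : R := ∏ i, x i ^ γ i

/-- The ideal `(x_1^{γ_1+1}, …, x_d^{γ_d+1})`. -/
def qq {R : Type*} [CommRing R] {d : ℕ} (x : Fin d → R) (γ : Fin d → ℕ) : Ideal R :=
  Ideal.span (Set.range fun i => x i ^ (γ i + 1))

/-- Monomial form of parametric decomposition. -/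
def PD (R : Type*) [CommRing R] (M : Type*) [AddCommGroup M] [Module R M]
    {d : ℕ} (x : Fin d → R) : Prop :=
  ∀ (γ : Fin d → ℕ) (m : M), mon x γ • m ∈ qq x γ • (⊤ : Submodule R M) →
    mon x γ • m ∈ (Ideal.span (Set.range x)) ^ ((∑ i, γ i) + 1) • (⊤ : Submodule R M)

section
variable {R : Type*} [CommRing R] {M : Type*} [AddCommGroup M] [Module R M] {d : ℕ}

lemma mon_add (x : Fin d → R) (β γ : Fin d → ℕ) : mon x (β + γ) = mon x β * mon x γ := by
  simp [mon, pow_add, Finset.prod_mul_distrib]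

lemma mon_single (x : Fin d → R) (k : Fin d) : mon x (Pi.single k 1) = x k := by
  classical
  unfold mon
  rw [Finset.prod_eq_single k]
  · simp
  · intro b _ hb
    simp [Pi.single_eq_of_ne hb]
  · simp

lemma pow_dvd_mon (x : Fin d → R) (γ : Fin d → ℕ) (i : Fin d) {n : ℕ} (h : n ≤ γ i) :
    x i ^ n ∣ mon x γ :=
  (pow_dvd_pow _ h).trans (Finset.dvd_prod_of_mem (fun i => x i ^ γ i) (Finset.mem_univ i))

lemma mon_mem_qq (x : Fin d → R) {γ δ : Fin d → ℕ} (i : Fin d) (h : δ i < γ i) :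
    mon x γ ∈ qq x δ :=
  Ideal.mem_of_dvd _ (pow_dvd_mon x γ i h) (Ideal.subset_span ⟨i, rfl⟩)

lemma exists_lt {γ δ : Fin d → ℕ} (hs : ∑ i, γ i = ∑ i, δ i) (hne : γ ≠ δ) : ∃ i, δ i < γ i := by
  by_contra! h
  apply hne
  funext i
  exact (Finset.sum_eq_sum_iff_of_le (fun i _ => h i)).1 hs i (Finset.mem_univ i)

lemma mon_mem_pow (x : Fin d → R) (γ : Fin d → ℕ) :
    mon x γ ∈ (Ideal.span (Set.range x)) ^ (∑ i, γ i) := by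
  rw [← Finset.prod_pow_eq_pow_sum]
  exact Ideal.prod_mem_prod fun i _ =>
    Ideal.pow_mem_pow (Ideal.subset_span (Set.mem_range_self i)) _

lemma pow_le_span (x : Fin d → R) (n : ℕ) : (Ideal.span (Set.range x)) ^ n ≤
    Ideal.span (mon x '' (Finset.piAntidiag Finset.univ n : Finset (Fin d → ℕ))) := by
  classical
  induction n with
  | zero =>
    refine le_of_le_of_eq le_top ?_
    symm
    rw [Ideal.eq_top_iff_one]
    refine Ideal.subset_span ⟨0, by simp, by simp [mon]⟩
  | succ n ih =>
    rw [pow_succ]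
    refine (Ideal.mul_mono_left ih).trans ?_
    rw [Ideal.span_mul_span', Ideal.span_le]
    rintro _ ⟨_, ⟨γ, hγ, rfl⟩, _, ⟨i, rfl⟩, rfl⟩
    refine Ideal.subset_span ⟨γ + Pi.single i 1, ?_, ?_⟩
    · simp at hγ ⊢
      simp [Finset.sum_add_distrib, hγ]
    · simp [mon_add, mon_single]

lemma repr (x : Fin d → R) (n : ℕ) {w : M}
    (hw : w ∈ (Ideal.span (Set.range x)) ^ n • (⊤ : Submodule R M)) :
    ∃ f : (Fin d → ℕ) → M, w = ∑ γ ∈ Finset.piAntidiag Finset.univ n, mon x γ • f γ := by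
  classical
  have h1 : w ∈ ⨆ γ ∈ (Finset.piAntidiag Finset.univ n : Finset (Fin d → ℕ)),
      Ideal.span {mon x γ} • (⊤ : Submodule R M) := by
    have := Submodule.smul_mono_left (N := (⊤ : Submodule R M)) (pow_le_span x n) hw
    rw [← Set.biUnion_of_singleton (mon x '' _), Ideal.span, Submodule.span_iUnion₂] at this
    simp only [Submodule.iSup_smul, iSup_image] at this
    simpa [Ideal.span] using this
  obtain ⟨μ, rfl⟩ := (Submodule.mem_iSup_finset_iff_exists_sum _ _).1 h1
  have h2 : ∀ γ, ∃ m : M, (μ γ : M) = mon x γ • m := by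
    intro γ
    obtain ⟨v, this⟩ := μ γ
    rw [Submodule.ideal_span_singleton_smul, Submodule.mem_smul_pointwise_iff_exists] at this
    obtain ⟨m, -, hm⟩ := this
    exact ⟨m, hm.symm⟩
  choose f hf using h2
  exact ⟨f, Finset.sum_congr rfl fun γ _ => hf γ⟩

lemma pd_of (x : Fin d → R) (h : HasParamDecomp R M x) : PD R M x := by
  intro γ m hm
  rw [h _ (Nat.le_add_left 1 _), Submodule.mem_iInf]
  intro α
  rw [Submodule.mem_iInf]
  rintro ⟨h1, h2⟩
  have hα : ∃ δ : Fin d → ℕ, α = fun i => δ i + 1 :=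
    ⟨fun i => α i - 1, funext fun i => by have := h1 i; simp only; omega⟩
  obtain ⟨δ, rfl⟩ := hα
  have hs : ∑ i, γ i = ∑ i, δ i := by
    simp [Finset.sum_add_distrib] at h2
    omega
  by_cases hne : γ = δ
  · subst hne
    exact hm
  · obtain ⟨i, hi⟩ := exists_lt hs hne
    exact Submodule.smul_mem_smul (mon_mem_qq x i hi) trivial

lemma PD.mem_pow {x : Fin d → R} (h : PD R M x) (n : ℕ) {w : M}
    (hw : w ∈ (Ideal.span (Set.range x)) ^ n • (⊤ : Submodule R M))
    (hq : ∀ γ : Fin d → ℕ, ∑ i, γ i = n → w ∈ qq x γ • (⊤ : Submodule R M)) :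
    w ∈ (Ideal.span (Set.range x)) ^ (n + 1) • (⊤ : Submodule R M) := by
  classical
  obtain ⟨f, rfl⟩ := repr x n hw
  refine Submodule.sum_mem _ fun γ hγ => ?_
  have hγ' : ∑ i, γ i = n := by simpa using hγ
  have := h γ (f γ) ?_
  · rwa [hγ'] at this
  · have h1 := hq γ hγ'
    rw [← Finset.add_sum_erase _ _ hγ] at h1
    refine (Submodule.add_mem_iff_left _ ?_).1 h1
    refine Submodule.sum_mem _ fun δ hδ => ?_
    simp at hδ
    obtain ⟨i, hi⟩ := exists_lt (hδ.2.trans hγ'.symm) hδ.1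
    exact Submodule.smul_mem_smul (mon_mem_qq x i hi) trivial

/-- component extraction -/
lemma comp_mem {x : Fin d → R} {n : ℕ} (f : (Fin d → ℕ) → M) (ε γ : Fin d → ℕ)
    (hγ : γ ∈ (Finset.piAntidiag Finset.univ n : Finset (Fin d → ℕ)))
    (hq : mon x ε • (∑ γ ∈ Finset.piAntidiag Finset.univ n, mon x γ • f γ) ∈
      qq x (ε + γ) • (⊤ : Submodule R M)) :
    mon x (ε + γ) • f γ ∈ qq x (ε + γ) • (⊤ : Submodule R M) := by
  classical
  have hγ' : ∑ i, γ i = n := by simpa using hγ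
  rw [← Finset.add_sum_erase _ _ hγ, smul_add, smul_smul, ← mon_add] at hq
  refine (Submodule.add_mem_iff_left _ ?_).1 hq
  rw [Finset.smul_sum]
  refine Submodule.sum_mem _ fun δ hδ => ?_
  simp at hδ
  obtain ⟨i, hi⟩ := exists_lt (hδ.2.trans hγ'.symm) hδ.1
  rw [smul_smul, ← mon_add]
  exact Submodule.smul_mem_smul (mon_mem_qq x i (by simpa using hi)) trivial

lemma PD.step {x : Fin d → R} (h : PD R M x) (β : Fin d → ℕ) (c : ℕ) (m : M)
    (hm : mon x β • m ∈ (Ideal.span (Set.range x)) ^ (∑ i, β i + c) • (⊤ : Submodule R M)) :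
    ∃ m' : M, m - m' ∈ (Ideal.span (Set.range x)) ^ c • (⊤ : Submodule R M) ∧
      mon x β • m' ∈ (Ideal.span (Set.range x)) ^ (∑ i, β i + c + 1) • (⊤ : Submodule R M) := by
  classical
  obtain ⟨f, hf⟩ := repr x _ hm
  set A : Finset (Fin d → ℕ) := Finset.piAntidiag Finset.univ (∑ i, β i + c) with hA
  set B := A.filter (fun γ => β ≤ γ) with hB
  have hmonB : ∀ γ ∈ B, mon x γ = mon x β * mon x (γ - β) := by
    intro γ hγ
    rw [← mon_add, add_tsub_cancel_of_le (Finset.mem_filter.1 hγ).2]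
  have hw : mon x β • (m - ∑ γ ∈ B, mon x (γ - β) • f γ) =
      ∑ γ ∈ A.filter (fun γ => ¬ β ≤ γ), mon x γ • f γ := by
    have h1 : mon x β • (∑ γ ∈ B, mon x (γ - β) • f γ) = ∑ γ ∈ B, mon x γ • f γ := by
      rw [Finset.smul_sum]
      exact Finset.sum_congr rfl (fun γ hγ => by rw [smul_smul, ← hmonB γ hγ])
    rw [smul_sub, hf, ← Finset.sum_filter_add_sum_filter_not A (fun γ => β ≤ γ), h1,
      add_sub_cancel_left]
  refine ⟨m - ∑ γ ∈ B, mon x (γ - β) • f γ, ?_, ?_⟩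
  · rw [sub_sub_cancel]
    refine Submodule.sum_mem _ fun γ hγ => Submodule.smul_mem_smul ?_ trivial
    have h1 := mon_mem_pow x (γ - β)
    have h2 : ∑ i, (γ - β) i = c := by
      have hγ1 := Finset.mem_filter.1 hγ
      have h3 : ∑ i, γ i = ∑ i, β i + c := by simpa [hA] using hγ1.1
      have h4 : ∑ i, (β i + (γ - β) i) = ∑ i, γ i :=
        Finset.sum_congr rfl fun i _ => by
          have : β i ≤ γ i := hγ1.2 i
          simp only [Pi.sub_apply]
          omega
      rw [Finset.sum_add_distrib] at h4
      omega
    rwa [h2] at h1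
  · apply h.mem_pow
    · rw [hw]
      refine Submodule.sum_mem _ fun γ hγ => Submodule.smul_mem_smul ?_ trivial
      have h1 := mon_mem_pow x γ
      have h3 : ∑ i, γ i = ∑ i, β i + c := by simpa [hA] using (Finset.mem_filter.1 hγ).1
      rwa [h3] at h1
    · intro γ hγ
      by_cases hle : β ≤ γ
      · rw [hw]
        refine Submodule.sum_mem _ fun δ hδ => Submodule.smul_mem_smul ?_ trivial
        have hδ' := Finset.mem_filter.1 hδ
        have h3 : ∑ i, δ i = ∑ i, β i + c := by simpa [hA] using hδ'.1
        obtain ⟨i, hi⟩ := exists_lt (h3.trans hγ.symm) (by rintro rfl; exact hδ'.2 hle)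
        exact mon_mem_qq x i hi
      · rw [Pi.le_def] at hle
        push Not at hle
        obtain ⟨i, hi⟩ := hle
        exact Submodule.smul_mem_smul (mon_mem_qq x i hi) trivial

lemma PD.iter {x : Fin d → R} (h : PD R M x) (β : Fin d → ℕ) (m : M)
    (hm : mon x β • m ∈ (Ideal.span (Set.range x)) ^ (∑ i, β i + 1) • (⊤ : Submodule R M)) (c : ℕ) :
    ∃ m' : M, m - m' ∈ (Ideal.span (Set.range x)) • (⊤ : Submodule R M) ∧
      mon x β • m' ∈ (Ideal.span (Set.range x)) ^ (∑ i, β i + (c + 1)) • (⊤ : Submodule R M) := by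
  induction c with
  | zero => exact ⟨m, by simp, hm⟩
  | succ c ih =>
    obtain ⟨m', h1, h2⟩ := ih
    obtain ⟨m'', h3, h4⟩ := h.step β (c + 1) m' h2
    refine ⟨m'', ?_, h4⟩
    rw [← sub_add_sub_cancel m m' m'']
    exact add_mem h1 (Submodule.smul_mono_left (Ideal.pow_le_self (by omega)) h3)

/-- `x^β m ∈ (x^{β+1})M` implies `m ∈ qM + (0 : x^β)`. -/
lemma PD.colon [IsNoetherianRing R] [Module.Finite R M]
    {x : Fin d → R} (h : PD R M x) (β : Fin d → ℕ) (m : M)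
    (hm : mon x β • m ∈ qq x β • (⊤ : Submodule R M)) :
    ∃ f : M, m - f ∈ (Ideal.span (Set.range x)) • (⊤ : Submodule R M) ∧ mon x β • f = 0 := by
  set q := Ideal.span (Set.range x) with hq
  obtain ⟨k, hk⟩ := q.exists_pow_inf_eq_pow_smul
    (LinearMap.range (LinearMap.lsmul R M (mon x β)))
  obtain ⟨m', h1, h2⟩ := h.iter β m (h β m hm) k
  have h3 : mon x β • m' ∈ q ^ (∑ i, β i + (k + 1)) • (⊤ : Submodule R M) ⊓
      LinearMap.range (LinearMap.lsmul R M (mon x β)) := ⟨h2, ⟨m', rfl⟩⟩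
  rw [hk _ (by omega)] at h3
  have h4 := Submodule.smul_mono (Ideal.pow_le_self (I := q)
    (n := ∑ i, β i + (k + 1) - k) (by omega)) inf_le_right h3
  rw [LinearMap.range_eq_map, ← Submodule.map_smul''] at h4
  obtain ⟨m0, hm0, h5⟩ := h4
  refine ⟨m' - m0, ?_, ?_⟩
  · rw [← sub_add]
    exact add_mem h1 hm0
  · rw [smul_sub, sub_eq_zero]
    exact h5.symm

end

/-- Goodness condition on colon submodules. -/
def HH (R : Type*) [CommRing R] (M : Type*) [AddCommGroup M] [Module R M]
    {d : ℕ} (x : Fin d → R) : Prop :=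
  ∀ (j : Fin d) (m : M), x j • m = 0 →
    m ∈ Ideal.span {r : R | ∃ i : Fin d, j ≤ i ∧ r = x i} • (⊤ : Submodule R M) → m = 0

section
variable {R : Type*} [CommRing R] {M : Type*} [AddCommGroup M] [Module R M] {d : ℕ}

lemma krull [IsLocalRing R] [IsNoetherianRing R] [Module.Finite R M] {q : Ideal R}
    (hq : q ≤ maximalIdeal R) (N : Submodule R M) {w : M}
    (hw : ∀ c : ℕ, w ∈ q ^ c • (⊤ : Submodule R M) ⊔ N) : w ∈ N := by
  have h := Ideal.iInf_pow_smul_eq_bot_of_isLocalRing (M := M ⧸ N) q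
    (fun h => (maximalIdeal.isMaximal R).ne_top (top_le_iff.1 (h ▸ hq)))
  rw [← Submodule.Quotient.mk_eq_zero, ← Submodule.mem_bot R, ← h, Submodule.mem_iInf]
  intro c
  have h1 := Submodule.mem_map_of_mem (f := N.mkQ) (hw c)
  rw [Submodule.map_sup, Submodule.map_smul'', Submodule.map_top, Submodule.range_mkQ] at h1
  simpa using h1

lemma mem_smul_of_dvd {I : Ideal R} {a b : R} (ha : a ∈ I) (h : a ∣ b) (m : M) :
    b • m ∈ I • (⊤ : Submodule R M) :=
  Submodule.smul_mem_smul (Ideal.mem_of_dvd _ h ha) trivial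

lemma mem_gen {S : Set R} {a b : R} (ha : a ∈ S) (h : a ∣ b) (m : M) :
    b • m ∈ Ideal.span S • (⊤ : Submodule R M) :=
  mem_smul_of_dvd (Ideal.subset_span ha) h m

lemma HH.app {x : Fin d → R} (hH : HH R M x) {j l : Fin d} (hl : j ≤ l) {b : R} (hb : x l ∣ b)
    {m : M} (h : x j • b • m = 0) : b • m = 0 :=
  hH j _ h (mem_gen (S := {r : R | ∃ i : Fin d, j ≤ i ∧ r = x i}) ⟨l, hl, rfl⟩ hb m)

lemma mem_of_sup {A B C : Submodule R M} {m : M} (h : m ∈ A ⊔ B) (hA : A ≤ C) (hB : B ≤ C) :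
    m ∈ C := (sup_le hA hB : A ⊔ B ≤ C) h

lemma split_term {x : Fin d → R} {n : ℕ} {γ : Fin d → ℕ} (hγ : ∑ i, γ i = n) {m f : M}
    (h : m - f ∈ Ideal.span (Set.range x) • (⊤ : Submodule R M)) {N : Submodule R M}
    (hf : mon x γ • f ∈ N) :
    mon x γ • m ∈ Ideal.span (Set.range x) ^ (n + 1) • (⊤ : Submodule R M) ⊔ N := by
  have : mon x γ • m = mon x γ • (m - f) + mon x γ • f := by rw [smul_sub]; abel
  rw [this]
  refine add_mem (Submodule.mem_sup_left ?_) (Submodule.mem_sup_right hf)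
  rw [pow_succ, Submodule.mul_smul]
  refine Submodule.smul_mem_smul ?_ h
  rw [← hγ]
  exact mon_mem_pow x γ

lemma stepA [IsLocalRing R] [IsNoetherianRing R] [Module.Finite R M]
    {x : Fin (d + 1) → R} (hx : ∀ i, x i ∈ maximalIdeal R) (hP : PD R M x) (k : Fin d) {m : M}
    (hm : x k.succ • m ∈ Ideal.span {x 0} • (⊤ : Submodule R M)) :
    m ∈ Ideal.span {x 0} • (⊤ : Submodule R M) ⊔ Submodule.torsionBy R M (x k.succ) := by
  classical
  refine krull (q := Ideal.span (Set.range x)) ?_ _ fun c => ?_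
  · rw [Ideal.span_le]
    rintro _ ⟨i, rfl⟩
    exact hx i
  induction c with
  | zero => exact Submodule.mem_sup_left (by simp)
  | succ c ih =>
    obtain ⟨u, hu, v, hv, rfl⟩ := Submodule.mem_sup.1 ih
    refine add_mem ?_ (Submodule.mem_sup_right hv)
    have hxu : x k.succ • u ∈ Ideal.span {x 0} • (⊤ : Submodule R M) := by
      rw [smul_add] at hm
      refine (Submodule.add_mem_iff_left _ ?_).1 hm
      obtain ⟨a, ha, b, hb, rfl⟩ := Submodule.mem_sup.1 hv
      rw [smul_add, (Submodule.mem_torsionBy_iff _ _).1 hb, add_zero]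
      exact Submodule.smul_mem _ _ ha
    obtain ⟨f, rfl⟩ := repr x c hu
    refine Submodule.sum_mem _ fun γ hγ => ?_
    have hγ' : ∑ i, γ i = c := by simpa using hγ
    by_cases h0 : γ 0 = 0
    · have h1 := comp_mem (x := x) f (Pi.single k.succ 1) γ hγ (by
        rw [mon_single]
        refine Submodule.smul_mono_left ?_ hxu
        rw [Ideal.span_le, Set.singleton_subset_iff]
        refine Ideal.subset_span ⟨0, ?_⟩
        have : (Pi.single k.succ 1 : Fin (d + 1) → ℕ) 0 = 0 :=
          Pi.single_eq_of_ne (Fin.succ_ne_zero k).symm _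
        simp [h0])
      obtain ⟨g, hg1, hg2⟩ := hP.colon _ _ h1
      rw [mon_add, mon_single, mul_smul] at hg2
      exact split_term hγ' hg1 (Submodule.mem_sup_right ((Submodule.mem_torsionBy_iff _ _).2 hg2))
    · refine Submodule.mem_sup_right (Submodule.mem_sup_left ?_)
      refine mem_smul_of_dvd (Ideal.mem_span_singleton_self (x 0)) ?_ _
      simpa using pow_dvd_mon x γ 0 (n := 1) (by omega)

lemma stepB [IsLocalRing R] [IsNoetherianRing R] [Module.Finite R M]
    {x : Fin (d + 1) → R} (hx : ∀ i, x i ∈ maximalIdeal R) (hH : HH R M x) (hP : PD R M x)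
    (j : Fin d) {e : M} (he : x j.succ • e = 0)
    (he2 : e ∈ Ideal.span {r : R | ∃ i : Fin (d + 1), (i = 0 ∨ j.succ ≤ i) ∧ r = x i} •
      (⊤ : Submodule R M)) :
    e ∈ Ideal.span {x 0} • (⊤ : Submodule R M) := by
  classical
  suffices h : e ∈ (Submodule.torsionBy R M (x j.succ)).map (LinearMap.lsmul R M (x 0)) by
    obtain ⟨g, -, rfl⟩ := h
    exact mem_smul_of_dvd (Ideal.mem_span_singleton_self (x 0)) dvd_rfl _
  refine krull (q := Ideal.span (Set.range x)) ?_ _ fun c => ?_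
  · rw [Ideal.span_le]
    rintro _ ⟨i, rfl⟩
    exact hx i
  induction c with
  | zero => exact Submodule.mem_sup_left (by simp)
  | succ c ih =>
    obtain ⟨u, hu, v, hv, rfl⟩ := Submodule.mem_sup.1 ih
    refine add_mem ?_ (Submodule.mem_sup_right hv)
    obtain ⟨g, hg, rfl⟩ := hv
    replace hg : x j.succ • g = 0 := (Submodule.mem_torsionBy_iff _ _).1 hg
    simp only [LinearMap.lsmul_apply] at he he2
    have hu1 : x j.succ • u = 0 := by
      rwa [smul_add, smul_comm, hg, smul_zero, add_zero] at he
    have hu2 := (Submodule.add_mem_iff_left _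
      (mem_gen (S := {r : R | ∃ i : Fin (d + 1), (i = 0 ∨ j.succ ≤ i) ∧ r = x i}) (a := x 0)
        ⟨0, Or.inl rfl, rfl⟩ dvd_rfl g)).1 he2
    have hu3 : ∀ l, j.succ ≤ l → x l • u = 0 := by
      intro l hl
      refine hH.app hl dvd_rfl ?_
      rw [smul_comm, hu1, smul_zero]
    obtain ⟨f, rfl⟩ := repr x c hu
    refine Submodule.sum_mem _ fun γ hγ => ?_
    have hγ' : ∑ i, γ i = c := by simpa using hγ
    have key : ∀ l, j.succ ≤ l → ∃ g, f γ - g ∈ Ideal.span (Set.range x) • (⊤ : Submodule R M) ∧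
        x l • mon x γ • g = 0 := by
      intro l hl
      have h1 := comp_mem (x := x) f (Pi.single l 1) γ hγ (by
        rw [mon_single, hu3 l hl]
        exact zero_mem _)
      obtain ⟨g, hg1, hg2⟩ := hP.colon _ _ h1
      rw [mon_add, mon_single, mul_smul] at hg2
      exact ⟨g, hg1, hg2⟩
    by_cases h0 : γ 0 = 0
    · by_cases hl : ∃ l, j.succ ≤ l ∧ γ l ≠ 0
      · obtain ⟨l, hl, hγl⟩ := hl
        obtain ⟨g, hg1, hg2⟩ := key l hl
        refine split_term hγ' hg1 ?_
        have : mon x γ • g = 0 := by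
          refine hH.app (le_refl l) ?_ hg2
          simpa using pow_dvd_mon x γ l (n := 1) (by omega)
        rw [this]
        exact zero_mem _
      · push Not at hl
        refine Submodule.mem_sup_left ?_
        rw [← hγ']
        apply hP
        have h1 := comp_mem (x := x) f 0 γ hγ (by
          have : mon x 0 = 1 := by simp [mon]
          rw [this, one_smul, zero_add]
          refine Submodule.smul_mono_left ?_ hu2
          rw [Ideal.span_le]
          rintro _ ⟨i, hi, rfl⟩
          refine Ideal.subset_span ⟨i, ?_⟩
          have : γ i = 0 := by
            rcases hi with rfl | hi
            · exact h0
            · exact hl i hi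
          simp [this])
        rwa [zero_add] at h1
    · obtain ⟨g, hg1, hg2⟩ := key j.succ le_rfl
      refine split_term hγ' hg1 ?_
      have h2 : γ = Pi.single 0 1 + (γ - Pi.single 0 1) := by
        rw [add_tsub_cancel_of_le]
        intro i
        by_cases hi : i = 0
        · subst hi
          simp
          omega
        · simp [Pi.single_eq_of_ne hi]
      rw [h2, mon_add, mon_single, mul_smul] at hg2 ⊢
      refine ⟨mon x (γ - Pi.single 0 1) • g, ?_, rfl⟩
      change _ ∈ Submodule.torsionBy R M (x j.succ)
      rw [Submodule.mem_torsionBy_iff]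
      refine hH.app (Fin.zero_le j.succ) dvd_rfl ?_
      rw [smul_comm, hg2]

lemma pow_sup_le (I J : Ideal R) (n : ℕ) : (I ⊔ J) ^ n ≤ I ⊔ J ^ n := by
  induction n with
  | zero => simp
  | succ n ih =>
    rw [pow_succ]
    refine (Ideal.mul_mono_left ih).trans ?_
    rw [Ideal.mul_le]
    intro r hr s hs
    obtain ⟨a, ha, b, hb, rfl⟩ := Submodule.mem_sup.1 hr
    obtain ⟨a', ha', b', hb', rfl⟩ := Submodule.mem_sup.1 hs
    have : (a + b) * (a' + b') = (a * (a' + b') + b * a') + b * b' := by ring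
    rw [this]
    refine add_mem (Submodule.mem_sup_left (add_mem (I.mul_mem_right _ ha) (I.mul_mem_left _ ha')))
      (Submodule.mem_sup_right ?_)
    rw [pow_succ]
    exact Ideal.mul_mem_mul hb hb'

lemma mem_sup_of_mkQ {N L : Submodule R M} {m : M} (h : N.mkQ m ∈ L.map N.mkQ) : m ∈ L ⊔ N := by
  obtain ⟨l, hl, h⟩ := h
  have : m = l + (m - l) := by abel
  rw [this]
  refine add_mem (Submodule.mem_sup_left hl) (Submodule.mem_sup_right ?_)
  rw [← Submodule.Quotient.mk_eq_zero, Submodule.Quotient.mk_sub, sub_eq_zero]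
  exact h.symm

lemma smul_top_quot (N : Submodule R M) (I : Ideal R) :
    I • (⊤ : Submodule R (M ⧸ N)) = (I • (⊤ : Submodule R M)).map N.mkQ := by
  rw [Submodule.map_smul'', Submodule.map_top, Submodule.range_mkQ]

lemma tor_quot {a b : R} {m : M} (N : Submodule R M) (hN : N = Ideal.span {a} • (⊤ : Submodule R M))
    (h : b • N.mkQ m = 0) : b • m ∈ Ideal.span {a} • (⊤ : Submodule R M) := by
  rw [← map_smul] at h
  rw [← hN]
  exact (Submodule.Quotient.mk_eq_zero _).1 h

lemma PD.quot {x : Fin (d + 1) → R} (hP : PD R M x) :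
    PD R (M ⧸ (Ideal.span {x 0} • (⊤ : Submodule R M))) (fun i : Fin d => x i.succ) := by
  intro γ m hm
  obtain ⟨m, rfl⟩ := Submodule.mkQ_surjective _ m
  rw [smul_top_quot, ← map_smul] at hm ⊢
  have h1 := mem_sup_of_mkQ hm
  have hmon : mon (fun i : Fin d => x i.succ) γ = mon x (Fin.cons 0 γ) := by
    simp [mon, Fin.prod_univ_succ]
  rw [hmon] at h1 ⊢
  have h2 := hP (Fin.cons 0 γ) m ?_
  · have h3 : Ideal.span (Set.range x) =
        Ideal.span {x 0} ⊔ Ideal.span (Set.range fun i : Fin d => x i.succ) := by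
      rw [← Ideal.span_union]
      congr 1
      ext r
      simp [Fin.exists_fin_succ, eq_comm]
    have h4 : ∑ i, (Fin.cons 0 γ : Fin (d + 1) → ℕ) i = ∑ i, γ i := by
      simp [Fin.sum_univ_succ]
    rw [h4, h3] at h2
    have h5 := Submodule.smul_mono_left (N := (⊤ : Submodule R M)) (pow_sup_le _ _ _) h2
    rw [Submodule.sup_smul] at h5
    have h6 := Submodule.mem_map_of_mem (f := (Ideal.span {x 0} • (⊤ : Submodule R M)).mkQ) h5
    have h7 : (Ideal.span {x 0} • (⊤ : Submodule R M)).map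
        (Ideal.span {x 0} • (⊤ : Submodule R M)).mkQ = ⊥ := Submodule.mkQ_map_self _
    rwa [Submodule.map_sup, h7, bot_sup_eq] at h6
  · refine mem_of_sup h1 (Submodule.smul_mono_left ?_) (Submodule.smul_mono_left ?_)
    · refine Ideal.span_le.2 ?_
      rintro _ ⟨i, rfl⟩
      exact Ideal.subset_span ⟨i.succ, by simp⟩
    · rw [Ideal.span_le, Set.singleton_subset_iff]
      exact Ideal.subset_span ⟨0, by simp⟩

lemma HH.quot [IsLocalRing R] [IsNoetherianRing R] [Module.Finite R M]
    {x : Fin (d + 1) → R} (hx : ∀ i, x i ∈ maximalIdeal R) (hH : HH R M x) (hP : PD R M x) :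
    HH R (M ⧸ (Ideal.span {x 0} • (⊤ : Submodule R M))) (fun i : Fin d => x i.succ) := by
  intro j m hm hm2
  obtain ⟨m, rfl⟩ := Submodule.mkQ_surjective _ m
  obtain ⟨a, ha, e, he, rfl⟩ := Submodule.mem_sup.1 (stepA hx hP j (tor_quot _ rfl hm))
  have ha0 : (Ideal.span {x 0} • (⊤ : Submodule R M)).mkQ a = 0 :=
    (Submodule.Quotient.mk_eq_zero _).2 ha
  rw [map_add, ha0, zero_add] at hm2 ⊢
  rw [smul_top_quot] at hm2
  refine (Submodule.Quotient.mk_eq_zero _).2 (stepB hx hH hP j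
    ((Submodule.mem_torsionBy_iff _ _).1 he) ?_)
  refine mem_of_sup (mem_sup_of_mkQ hm2) (Submodule.smul_mono_left ?_) (Submodule.smul_mono_left ?_)
  · refine Ideal.span_le.2 ?_
    rintro _ ⟨i, hi, rfl⟩
    exact Ideal.subset_span ⟨i.succ, Or.inr (Fin.succ_le_succ_iff.2 hi), rfl⟩
  · rw [Ideal.span_le, Set.singleton_subset_iff]
    exact Ideal.subset_span ⟨0, Or.inl rfl, rfl⟩

end

theorem reg {R : Type*} [CommRing R] [IsLocalRing R] [IsNoetherianRing R] (d : ℕ) :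
    ∀ {M : Type*} [AddCommGroup M] [Module R M] [Module.Finite R M] (x : Fin d → R)
    (_ : ∀ i, x i ∈ maximalIdeal R) (_ : HH R M x) (_ : PD R M x) (j k : Fin d) (_ : j ≤ k) (m : M)
    (_ : x j • m ∈ Ideal.span {r : R | ∃ i : Fin d, i < j ∧ r = x i} • (⊤ : Submodule R M) ⊔
      Submodule.torsionBy R M (x k)),
    m ∈ Ideal.span {r : R | ∃ i : Fin d, i < j ∧ r = x i} • (⊤ : Submodule R M) ⊔
      Submodule.torsionBy R M (x k) := by
  induction d with
  | zero => intro M _ _ _ x _ _ _ j; exact j.elim0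
  | succ d ih =>
    intro M _ _ _ x hx hH hP j k hjk m hm
    induction j using Fin.cases with
    | zero =>
      have h0 : {r : R | ∃ i : Fin (d + 1), i < 0 ∧ r = x i} = ∅ := by
        ext r
        simp
      rw [h0, Ideal.span_empty, Submodule.bot_smul, bot_sup_eq,
        Submodule.mem_torsionBy_iff] at hm ⊢
      refine hH.app (Fin.zero_le k) dvd_rfl ?_
      rw [smul_comm, hm]
    | succ j =>
      induction k using Fin.cases with
      | zero => exact absurd hjk (by simp)
      | succ k =>
        have hjk' : j ≤ k := Fin.succ_le_succ_iff.1 hjk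
        set N : Submodule R M := Ideal.span {x 0} • (⊤ : Submodule R M) with hN
        set J : Ideal R := Ideal.span {r : R | ∃ i : Fin d, i < j ∧ r = x i.succ} with hJ
        have hspan : Ideal.span {r : R | ∃ i : Fin (d + 1), i < j.succ ∧ r = x i} =
            Ideal.span {x 0} ⊔ J := by
          rw [hJ, ← Ideal.span_union]
          congr 1
          ext r
          simp [Fin.exists_fin_succ]
        rw [hspan, Submodule.sup_smul, ← hN] at hm ⊢
        have hN0 : N.map N.mkQ = ⊥ := Submodule.mkQ_map_self _
        have htor : (Submodule.torsionBy R M (x k.succ)).map N.mkQ =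
            Submodule.torsionBy R (M ⧸ N) (x k.succ) := by
          apply le_antisymm
          · rintro _ ⟨e, he, rfl⟩
            rw [Submodule.mem_torsionBy_iff, ← map_smul, (Submodule.mem_torsionBy_iff _ _).1 he,
              map_zero]
          · intro e he
            obtain ⟨e, rfl⟩ := Submodule.mkQ_surjective _ e
            have h1 := stepA hx hP k (tor_quot N hN ((Submodule.mem_torsionBy_iff _ _).1 he))
            have h2 := Submodule.mem_map_of_mem (f := N.mkQ) h1
            rwa [Submodule.map_sup, ← hN, hN0, bot_sup_eq] at h2
        have h1 := ih (M := M ⧸ N) (fun i => x i.succ) (fun i => hx _) (hH.quot hx hP) hP.quot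
          j k hjk' (N.mkQ m) (by
            have h2 := Submodule.mem_map_of_mem (f := N.mkQ) hm
            rw [Submodule.map_sup, Submodule.map_sup, hN0, bot_sup_eq, htor, map_smul,
              ← smul_top_quot] at h2
            exact h2)
        change N.mkQ m ∈ J • (⊤ : Submodule R (M ⧸ N)) ⊔ _ at h1
        rw [smul_top_quot, ← htor, ← Submodule.map_sup] at h1
        have h2 := mem_sup_of_mkQ h1
        rwa [sup_comm, ← sup_assoc] at h2

section dims
variable {R : Type*} [CommRing R] [IsLocalRing R] [IsNoetherianRing R]

lemma dimBound {N : Type*} [AddCommGroup N] [Module R N] (s : Finset R)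
    (hs : ∀ r ∈ s, r ∈ maximalIdeal R)
    (h : ∀ p : Ideal R, p.IsPrime → Module.annihilator R N ≤ p → Ideal.span (s : Set R) ≤ p →
      maximalIdeal R ≤ p) : moduleDim R N ≤ (s.card : WithBot ℕ∞) := by
  classical
  unfold moduleDim
  rcases subsingleton_or_nontrivial (R ⧸ Module.annihilator R N) with h0 | h0
  · simp [ringKrullDim_eq_bot_of_subsingleton]
  set f := Ideal.Quotient.mk (Module.annihilator R N) with hf
  have hfs : Function.Surjective f := Ideal.Quotient.mk_surjective
  have : IsLocalRing (R ⧸ Module.annihilator R N) := IsLocalRing.of_surjective' f hfs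
  rw [← IsLocalRing.maximalIdeal_height_eq_ringKrullDim]
  have hm : maximalIdeal (R ⧸ Module.annihilator R N) ∈
      (Ideal.span ((s.image f : Finset _) : Set (R ⧸ Module.annihilator R N))).minimalPrimes := by
    have hcm : (maximalIdeal (R ⧸ Module.annihilator R N)).comap f = maximalIdeal R := by
      have : ((maximalIdeal (R ⧸ Module.annihilator R N)).comap f).IsMaximal :=
        Ideal.comap_isMaximal_of_surjective f hfs
      exact IsLocalRing.eq_maximalIdeal this
    refine ⟨⟨inferInstance, ?_⟩, ?_⟩
    · rw [Ideal.span_le]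
      intro y hy
      simp only [Finset.coe_image, Set.mem_image, Finset.mem_coe] at hy
      obtain ⟨r, hr, rfl⟩ := hy
      have := hs r hr
      rw [← hcm] at this
      exact this
    · rintro q ⟨hq, hq2⟩ -
      have := h (q.comap f) (Ideal.comap_isPrime f q) ?_ ?_
      · intro y hy
        obtain ⟨r, rfl⟩ := hfs y
        have h1 : r ∈ maximalIdeal R := by rw [← hcm]; exact hy
        exact this h1
      · intro a ha
        rw [Ideal.mem_comap, hf, Ideal.Quotient.eq_zero_iff_mem.2 ha]
        exact q.zero_mem
      · rw [Ideal.span_le]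
        intro r hr
        exact hq2 (Ideal.subset_span (by simpa using ⟨r, hr, rfl⟩))
  have h1 := Ideal.height_le_card_of_mem_minimalPrimes_span_finset hm
  have h2 : ((s.image f).card : ℕ∞) ≤ (s.card : ℕ∞) := by exact_mod_cast Finset.card_image_le
  exact_mod_cast h1.trans h2

variable {M : Type*} [AddCommGroup M] [Module R M] [Module.Finite R M] {d : ℕ}

lemma sop_prime {x : Fin d → R} (h : IsSOP R M x) (p : Ideal R) (hp : p.IsPrime)
    (h1 : Module.annihilator R M ≤ p) (h2 : Ideal.span (Set.range x) ≤ p) : maximalIdeal R ≤ p := by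
  obtain ⟨-, hfl⟩ := h
  have hA := (isFiniteLength_iff_isNoetherian_isArtinian.1 hfl).2
  have hmem : (⟨p, hp⟩ : PrimeSpectrum R) ∈
      Module.support R (M ⧸ (Ideal.span (Set.range x) • (⊤ : Submodule R M))) := by
    rw [Module.support_quotient, Module.support_eq_zeroLocus]
    exact ⟨by simpa [PrimeSpectrum.mem_zeroLocus] using h1,
      by simpa [PrimeSpectrum.mem_zeroLocus, Ideal.span_le] using h2⟩
  obtain ⟨v, hv⟩ := Module.mem_support_iff_exists_annihilator.1 hmem
  intro a ha
  obtain ⟨n, ⟨w, hw⟩, hy⟩ := IsArtinian.exists_pow_succ_smul_dvd a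
    (⟨v, Submodule.mem_span_singleton_self v⟩ : Submodule.span R {v})
  obtain ⟨c, rfl⟩ := Submodule.mem_span_singleton.1 hw
  have hy' : a ^ n.succ • c • v = a ^ n • v := congrArg Subtype.val hy
  have hu : IsUnit (1 - a * c) := by
    by_contra hn
    have h3 : 1 - a * c ∈ maximalIdeal R := hn
    have h4 := (maximalIdeal R).add_mem h3 ((maximalIdeal R).mul_mem_right c ha)
    rw [sub_add_cancel] at h4
    exact (Ideal.ne_top_iff_one _).1 (maximalIdeal.isMaximal R).ne_top h4
  have h5 : (1 - a * c) • (a ^ n • v) = 0 := by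
    have h8 : (a * c * a ^ n) • v = a ^ n • v := by
      rw [← hy', smul_smul, pow_succ]
      congr 1
      ring
    rw [sub_smul, one_smul, smul_smul, h8, sub_self]
  have h6 : a ^ n • v = 0 := by
    obtain ⟨u, hu⟩ := hu
    rw [← hu] at h5
    have := congrArg (fun z => (↑u⁻¹ : R) • z) h5
    simpa [smul_smul] using this
  have h7 : a ^ n ∈ p := hv (by rw [Submodule.mem_annihilator_span_singleton]; exact h6)
  exact hp.mem_of_pow_mem n h7

lemma h0_dim : moduleDim R ↥(H0m R M) ≤ 0 := by
  have := dimBound (R := R) (N := ↥(H0m R M)) ∅ (by simp) ?_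
  · simpa using this
  intro p hp h1 _ a ha
  have hmem : (⟨p, hp⟩ : PrimeSpectrum R) ∈ Module.support R ↥(H0m R M) := by
    rw [Module.support_eq_zeroLocus]
    simpa [PrimeSpectrum.mem_zeroLocus] using h1
  obtain ⟨⟨v, hvm⟩, hv⟩ := Module.mem_support_iff_exists_annihilator.1 hmem
  unfold H0m at hvm
  rw [Submodule.mem_iSup_of_directed] at hvm
  · obtain ⟨n, hn⟩ := hvm
    rw [Submodule.mem_torsionBySet_iff] at hn
    have h7 : a ^ n ∈ p := hv (by
      rw [Submodule.mem_annihilator_span_singleton]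
      exact Subtype.ext (hn ⟨a ^ n, Ideal.pow_mem_pow ha n⟩))
    exact hp.mem_of_pow_mem n h7
  · refine Monotone.directed_le ?_
    intro a b hab
    exact Submodule.torsionBySet_le_torsionBySet_of_subset (Ideal.pow_le_pow_right hab)

end dims

section filt
variable {R : Type*} [CommRing R] [IsLocalRing R] [IsNoetherianRing R]
variable {M : Type*} [AddCommGroup M] [Module R M] [Module.Finite R M] {d t : ℕ}
  {D : Fin (t + 1) → Submodule R M} {ds : Fin (t + 1) → ℕ} {x : Fin d → R}

lemma bot_dim : moduleDim R ↥(⊥ : Submodule R M) = ⊥ := by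
  unfold moduleDim
  have : Module.annihilator R ↥(⊥ : Submodule R M) = ⊤ := Submodule.annihilator_bot
  rw [this]
  have : Subsingleton (R ⧸ (⊤ : Ideal R)) := Ideal.Quotient.subsingleton_iff.2 rfl
  exact ringKrullDim_eq_bot_of_subsingleton

lemma top_dim : moduleDim R ↥(⊤ : Submodule R M) = moduleDim R M := by
  unfold moduleDim
  have : Module.annihilator R ↥(⊤ : Submodule R M) = Module.annihilator R M :=
    Submodule.annihilator_top
  rw [this]

lemma ds_zero (hD : IsDimFiltration R M D)
    (hds : ∀ i, (D i = ⊥ ∧ ds i = 0) ∨ moduleDim R ↥(D i) = (ds i : WithBot ℕ∞)) : ds 0 = 0 := by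
  rcases hds 0 with h | h
  · exact h.2
  · have h1 := h0_dim (R := R) (M := M)
    rw [← hD.1, h] at h1
    have h2 : ds 0 ≤ 0 := by exact_mod_cast h1
    omega

lemma ds_last (hd : moduleDim R M = (d : WithBot ℕ∞)) (hD : IsDimFiltration R M D)
    (hds : ∀ i, (D i = ⊥ ∧ ds i = 0) ∨ moduleDim R ↥(D i) = (ds i : WithBot ℕ∞)) :
    ds (Fin.last t) = d := by
  have h2 := top_dim (R := R) (M := M)
  rw [← hD.2.1, hd] at h2
  rcases hds (Fin.last t) with h | h
  · rw [h.1, bot_dim] at h2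
    exact absurd h2.symm (WithBot.coe_ne_bot)
  · rw [h] at h2
    exact_mod_cast h2

lemma dim_succ (hD : IsDimFiltration R M D)
    (hds : ∀ i, (D i = ⊥ ∧ ds i = 0) ∨ moduleDim R ↥(D i) = (ds i : WithBot ℕ∞)) (i : Fin t) :
    moduleDim R ↥(D i.succ) = (ds i.succ : WithBot ℕ∞) := by
  rcases hds i.succ with h | h
  · have := (hD.2.2 i).2.1
    rw [h.1, bot_dim] at this
    exact absurd this not_lt_bot
  · exact h

lemma ds_mono (hD : IsDimFiltration R M D)
    (hds : ∀ i, (D i = ⊥ ∧ ds i = 0) ∨ moduleDim R ↥(D i) = (ds i : WithBot ℕ∞)) :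
    Monotone ds := by
  rw [Fin.monotone_iff_le_succ]
  intro i
  rcases hds i.castSucc with h | h
  · rw [h.2]; exact Nat.zero_le _
  · have := (hD.2.2 i).2.1
    rw [h, dim_succ hD hds i] at this
    have h2 : ds i.castSucc < ds i.succ := by exact_mod_cast this
    exact h2.le

lemma good_le (hg : IsGoodSOP R M D ds x) {i : Fin (t + 1)} (hi : (i : ℕ) < t) {j : Fin d}
    (hj : ds i ≤ j) : D i ≤ Submodule.torsionBy R M (x j) := by
  intro m hm
  rw [Submodule.mem_torsionBy_iff]
  have h := hg.2 i hi
  have h1 : x j • m ∈ D i ⊓ (Ideal.span {r : R | ∃ j : Fin d, ds i ≤ (j : ℕ) ∧ r = x j}) •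
        (⊤ : Submodule R M) :=
    ⟨(D i).smul_mem _ hm, mem_gen (S := {r : R | ∃ j : Fin d, ds i ≤ (j : ℕ) ∧ r = x j})
      ⟨j, hj, rfl⟩ dvd_rfl m⟩
  rw [h] at h1
  simpa using h1

lemma tor_le (hd : moduleDim R M = (d : WithBot ℕ∞)) (hD : IsDimFiltration R M D)
    (hds : ∀ i, (D i = ⊥ ∧ ds i = 0) ∨ moduleDim R ↥(D i) = (ds i : WithBot ℕ∞))
    (hg : IsGoodSOP R M D ds x) (i : Fin t) (j : Fin d) (hj : (j : ℕ) < ds i.succ)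
    (k : Fin (t + 1)) : i.castSucc ≤ k → Submodule.torsionBy R M (x j) ≤ D k := by
  classical
  induction k using Fin.reverseInduction with
  | last => intro _; rw [hD.2.1]; exact le_top
  | cast k ih =>
    intro hk
    have hik : i ≤ k := by simpa using hk
    have hN := ih (hk.trans (Fin.castSucc_lt_succ).le)
    refine (hD.2.2 k).2.2 _ hN ?_
    have hjk : (j : ℕ) < ds k.succ :=
      lt_of_lt_of_le hj (ds_mono hD hds (Fin.succ_le_succ_iff.2 hik))
    rw [dim_succ hD hds k]
    set n := ds k.succ with hn
    have hnd : n ≤ d := by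
      rw [← ds_last hd hD hds]; exact ds_mono hD hds (Fin.le_last _)
    set T : Finset (Fin d) := (Finset.univ.filter (fun l : Fin d => (l : ℕ) < n)).erase j with hT
    have hcard : T.card < n := by
      have h1 : T.card < (Finset.univ.filter (fun l : Fin d => (l : ℕ) < n)).card :=
        Finset.card_erase_lt_of_mem (by simpa using hjk)
      refine lt_of_lt_of_le h1 ?_
      have := Finset.card_le_card_of_injOn (s := Finset.univ.filter (fun l : Fin d => (l : ℕ) < n))
        (t := Finset.range n) (fun l : Fin d => (l : ℕ)) (by intro l hl; simpa using hl)
        (by intro a _ b _ h; exact Fin.ext h)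
      simpa using this
    have hb := dimBound (R := R) (N := ↥(Submodule.torsionBy R M (x j))) (T.image x) ?_ ?_
    · refine lt_of_le_of_lt hb ?_
      have : (T.image x).card < n := lt_of_le_of_lt Finset.card_image_le hcard
      exact_mod_cast this
    · intro r hr
      obtain ⟨l, -, rfl⟩ := Finset.mem_image.1 hr
      exact hg.1.1 l
    · intro p hp h1 h2
      refine sop_prime hg.1 p hp ?_ ?_
      · refine le_trans ?_ h1
        intro a ha
        rw [Module.mem_annihilator] at ha ⊢
        intro m
        exact Subtype.ext (ha m)
      · rw [Ideal.span_le]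
        rintro _ ⟨l, rfl⟩
        by_cases hl : l ∈ T
        · exact h2 (Ideal.subset_span (by simpa using ⟨l, hl, rfl⟩))
        · refine h1 ?_
          rw [Module.mem_annihilator]
          rintro ⟨m, hm⟩
          refine Subtype.ext ?_
          change x l • m = 0
          by_cases hlj : l = j
          · rw [hlj]; simpa using hm
          · have hln : n ≤ l := by
              by_contra hc
              exact hl (by simp [hT, hlj]; omega)
            have hkt : (k.succ : ℕ) < t := by
              by_contra hc
              have : k.succ = Fin.last t := by
                apply Fin.ext; have := k.succ.2; rw [Fin.val_last]; omega
              have h3 := ds_last hd hD hds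
              rw [← this] at h3
              have := l.2
              omega
            have := good_le hg hkt (hn ▸ hln) (hN hm)
            simpa using this

lemma tor_eq (hd : moduleDim R M = (d : WithBot ℕ∞)) (hD : IsDimFiltration R M D)
    (hds : ∀ i, (D i = ⊥ ∧ ds i = 0) ∨ moduleDim R ↥(D i) = (ds i : WithBot ℕ∞))
    (hg : IsGoodSOP R M D ds x) (i : Fin t) (j : Fin d) (hj : (j : ℕ) < ds i.succ)
    (hj' : ds i.castSucc ≤ j) : Submodule.torsionBy R M (x j) = D i.castSucc :=
  le_antisymm (tor_le hd hD hds hg i j hj _ le_rfl) (good_le hg (by simp) hj')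

lemma find_idx (hd : moduleDim R M = (d : WithBot ℕ∞)) (hD : IsDimFiltration R M D)
    (hds : ∀ i, (D i = ⊥ ∧ ds i = 0) ∨ moduleDim R ↥(D i) = (ds i : WithBot ℕ∞))
    (j : Fin d) : ∃ i : Fin t, ds i.castSucc ≤ j ∧ (j : ℕ) < ds i.succ := by
  by_contra hc
  push Not at hc
  have h : ∀ k : Fin (t + 1), ds k ≤ j := by
    intro k
    induction k using Fin.induction with
    | zero => rw [ds_zero hD hds]; exact Nat.zero_le _
    | succ k ih => exact hc k ih
  have h1 := h (Fin.last t)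
  rw [ds_last hd hD hds] at h1
  have := j.2
  omega

lemma hh_of (hd : moduleDim R M = (d : WithBot ℕ∞)) (hD : IsDimFiltration R M D)
    (hds : ∀ i, (D i = ⊥ ∧ ds i = 0) ∨ moduleDim R ↥(D i) = (ds i : WithBot ℕ∞))
    (hg : IsGoodSOP R M D ds x) : HH R M x := by
  intro j m h1 h2
  obtain ⟨i, hi1, hi2⟩ := find_idx hd hD hds j
  have h3 : m ∈ D i.castSucc := by
    rw [← tor_eq hd hD hds hg i j hi2 hi1]; simpa using h1
  have h4 : m ∈ D i.castSucc ⊓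
      (Ideal.span {r : R | ∃ j : Fin d, ds i.castSucc ≤ (j : ℕ) ∧ r = x j}) •
        (⊤ : Submodule R M) := by
    refine ⟨h3, Submodule.smul_mono_left (Ideal.span_mono ?_) h2⟩
    rintro r ⟨l, hl, rfl⟩
    exact ⟨l, hi1.trans hl, rfl⟩
  rw [hg.2 _ (by simp)] at h4
  simpa using h4

end filt

section final
variable {R : Type*} [CommRing R] {M : Type*} [AddCommGroup M] [Module R M] {d : ℕ}

/-- Ideal generated by the first `r` elements. -/
def JJ (x : Fin d → R) (r : ℕ) : Ideal R := Ideal.span {a : R | ∃ i : Fin d, (i : ℕ) < r ∧ a = x i}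

lemma JJ_succ (x : Fin d → R) (j : Fin d) : JJ x (j + 1) = JJ x j ⊔ Ideal.span {x j} := by
  unfold JJ
  rw [← Ideal.span_union]
  congr 1
  ext a
  constructor
  · rintro ⟨i, hi, rfl⟩
    rcases Nat.lt_succ_iff_lt_or_eq.1 hi with h | h
    · exact Or.inl ⟨i, h, rfl⟩
    · right; rw [Fin.ext h]; rfl
  · rintro (⟨i, hi, rfl⟩ | rfl)
    · exact ⟨i, by omega, rfl⟩
    · exact ⟨j, by omega, rfl⟩

lemma inter (x : Fin d → R) (L : Submodule R M) (n : ℕ) (hn : n ≤ d)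
    (H : ∀ j : Fin d, (j : ℕ) < n → ∀ m : M, x j • m ∈ JJ x j • (⊤ : Submodule R M) ⊔ L →
      m ∈ JJ x j • (⊤ : Submodule R M) ⊔ L) (r : ℕ) (hr : r ≤ n) :
    JJ x r • (⊤ : Submodule R M) ⊓ L ≤ JJ x r • L := by
  induction r with
  | zero =>
    have : JJ x 0 = ⊥ := by
      unfold JJ
      rw [Ideal.span_eq_bot]
      rintro _ ⟨i, hi, -⟩
      omega
    rw [this]
    simp
  | succ r ih =>
    have ih := ih (by omega)
    let j : Fin d := ⟨r, by omega⟩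
    have hs : JJ x (r + 1) = JJ x r ⊔ Ideal.span {x j} := JJ_succ x j
    have H' : ∀ m : M, x j • m ∈ JJ x r • (⊤ : Submodule R M) ⊔ L →
      m ∈ JJ x r • (⊤ : Submodule R M) ⊔ L := H j (by change r < n; omega)
    rw [hs, Submodule.sup_smul, Submodule.sup_smul, Submodule.ideal_span_singleton_smul,
      Submodule.ideal_span_singleton_smul]
    rintro m ⟨h1, h2⟩
    obtain ⟨u, hu, z, hz, rfl⟩ := Submodule.mem_sup.1 h1
    obtain ⟨w, -, rfl⟩ := hz
    change u + x j • w ∈ L at h2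
    change u + x j • w ∈ _
    have h3 : x j • w ∈ JJ x r • (⊤ : Submodule R M) ⊔ L := by
      have : x j • w = -u + (u + x j • w) := by abel
      rw [this]
      exact Submodule.add_mem_sup (neg_mem hu) h2
    obtain ⟨u', hu', l, hl, rfl⟩ := Submodule.mem_sup.1 (H' w h3)
    have h4 : u + x j • u' ∈ JJ x r • L := by
      refine ih ⟨add_mem hu (Submodule.smul_mem _ _ hu'), ?_⟩
      have : u + x j • u' = (u + x j • (u' + l)) - x j • l := by rw [smul_add]; abel
      rw [this]
      exact sub_mem h2 (L.smul_mem _ hl)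
    have : u + x j • (u' + l) = (u + x j • u') + x j • l := by rw [smul_add]; abel
    rw [this]
    exact Submodule.add_mem_sup h4 (Submodule.smul_mem_pointwise_smul l (x j) L hl)

lemma weakReg (x : Fin d → R) (L E : Submodule R M) (hEL : E ≤ L) (n : ℕ) (hn : n ≤ d)
    (H : ∀ j : Fin d, (j : ℕ) < n → ∀ m ∈ L, x j • m ∈ JJ x j • L ⊔ E → m ∈ JJ x j • L ⊔ E) :
    RingTheory.Sequence.IsWeaklyRegular (↥L ⧸ E.comap L.subtype)
      (List.ofFn (fun i : Fin n => x ⟨i, by omega⟩)) := by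
  rw [RingTheory.Sequence.isWeaklyRegular_iff]
  intro i hi
  have hin : i < n := by simpa using hi
  have hJ : Ideal.ofList ((List.ofFn (fun i : Fin n => x ⟨i, by omega⟩)).take i) = JJ x i := by
    unfold Ideal.ofList JJ
    congr 1
    ext a
    rw [Set.mem_setOf_eq, Set.mem_setOf_eq, List.mem_take_iff_getElem]
    constructor
    · rintro ⟨l, hl, rfl⟩
      have : l < i := by omega
      exact ⟨⟨l, by omega⟩, this, by simp⟩
    · rintro ⟨l, hl, rfl⟩
      exact ⟨l, by simp; omega, by simp⟩
  rw [hJ, isSMulRegular_quotient_iff_mem_of_smul_mem, smul_top_quot]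
  have hmap : (JJ x i • (⊤ : Submodule R ↥L)).map L.subtype = JJ x i • L := by
    rw [Submodule.map_smul'', Submodule.map_subtype_top]
  have hget : (List.ofFn (fun i : Fin n => x ⟨i, by omega⟩))[i] = x ⟨i, by omega⟩ := by simp
  rw [hget]
  intro y hy
  obtain ⟨y, rfl⟩ := Submodule.mkQ_surjective _ y
  rw [← map_smul] at hy
  have h1 := Submodule.mem_map_of_mem (f := L.subtype) (mem_sup_of_mkQ hy)
  rw [Submodule.map_sup, hmap] at h1
  have h2 : x ⟨i, by omega⟩ • (y : M) ∈ JJ x i • L ⊔ E :=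
    mem_of_sup h1 le_sup_left (le_sup_of_le_right (Submodule.map_comap_le _ _))
  have h3 := H ⟨i, by omega⟩ hin y y.2 h2
  change (y : M) ∈ JJ x i • L ⊔ E at h3
  rw [← hmap] at h3
  obtain ⟨u, ⟨u', hu', rfl⟩, e, he, hue⟩ := Submodule.mem_sup.1 h3
  refine ⟨u', hu', ?_⟩
  rw [← sub_eq_zero, ← map_sub]
  rw [Submodule.mkQ_apply, Submodule.Quotient.mk_eq_zero, Submodule.mem_comap, map_sub]
  have : L.subtype u' - L.subtype y = -e := by
    change L.subtype u' - (y : M) = -e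
    rw [← hue]; abel
  rw [this]
  exact neg_mem he

lemma cm_of [IsLocalRing R] [IsNoetherianRing R] {N : Type*} [AddCommGroup N] [Module R N]
    [Module.Finite R N] [Nontrivial N] (rs : List R) (hrs : ∀ r ∈ rs, r ∈ maximalIdeal R)
    (hw : RingTheory.Sequence.IsWeaklyRegular N rs)
    (hdim : moduleDim R N ≤ (rs.length : WithBot ℕ∞)) : IsCM R N := by
  have hreg := (IsLocalRing.isRegular_iff_isWeaklyRegular_of_subset_maximalIdeal hrs).2 hw
  have h1 : ((rs.length : ℕ∞)) ≤ moduleDepth R N := le_sSup ⟨rs, rfl, hrs, hreg⟩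
  have hsd : moduleDim R N = Module.supportDim R N :=
    (Module.supportDim_eq_ringKrullDim_quotient_annihilator R N).symm
  have key : ∀ ss : List R, RingTheory.Sequence.IsRegular N ss →
      ((ss.length : ℕ∞) : WithBot ℕ∞) ≤ moduleDim R N := by
    intro ss hss
    have h2 := Module.supportDim_add_length_eq_supportDim_of_isRegular ss hss
    rw [hsd, ← h2]
    have : Nontrivial (N ⧸ Ideal.ofList ss • (⊤ : Submodule R N)) :=
      Submodule.Quotient.nontrivial_iff.2 hss.top_ne_smul.symm
    have h3 := Module.supportDim_ne_bot_of_nontrivial R (N ⧸ Ideal.ofList ss • (⊤ : Submodule R N))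
    obtain ⟨e, he⟩ := WithBot.ne_bot_iff_exists.1 h3
    rw [← he]
    have h4 : (ss.length : ℕ∞) ≤ e + ss.length := le_add_self
    exact_mod_cast h4
  have h0 : moduleDim R N = ((rs.length : ℕ∞) : WithBot ℕ∞) := le_antisymm hdim (key rs hreg)
  unfold IsCM
  rw [h0]
  refine congrArg _ (le_antisymm (sSup_le ?_) h1)
  rintro _ ⟨ss, rfl, -, hss⟩
  have := key ss hss
  rw [h0] at this
  exact_mod_cast this

end final

theorem main {R : Type*} [CommRing R] [IsLocalRing R] [IsNoetherianRing R]
    {M : Type*} [AddCommGroup M] [Module R M] [Module.Finite R M]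
    {d t : ℕ} (hd : moduleDim R M = (d : WithBot ℕ∞))
    (D : Fin (t + 1) → Submodule R M) (hD : IsDimFiltration R M D)
    (ds : Fin (t + 1) → ℕ)
    (hds : ∀ i, (D i = ⊥ ∧ ds i = 0) ∨ moduleDim R ↥(D i) = (ds i : WithBot ℕ∞))
    (x : Fin d → R) (hg : IsGoodSOP R M D ds x) (hpd : HasParamDecomp R M x)
    (i : Fin t) : IsCM R (↥(D i.succ) ⧸ (D i.castSucc).comap (D i.succ).subtype) := by
  have hH := hh_of hd hD hds hg
  have hP := pd_of x hpd
  have hreg := reg d x hg.1.1 hH hP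
  have hnd : ds i.succ ≤ d := by
    rw [← ds_last hd hD hds]; exact ds_mono hD hds (Fin.le_last _)
  have hEL := (hD.2.2 i).1
  have hlt := (hD.2.2 i).2.1
  -- regularity modulo the bigger layer
  have hL : ∀ j : Fin d, (j : ℕ) < ds i.succ → ∀ m : M,
      x j • m ∈ JJ x j • (⊤ : Submodule R M) ⊔ D i.succ →
      m ∈ JJ x j • (⊤ : Submodule R M) ⊔ D i.succ := by
    intro j hj m hm
    by_cases hit : i.succ = Fin.last t
    · rw [hit, hD.2.1]; simp
    · obtain ⟨i', hi'⟩ : ∃ i' : Fin t, i'.castSucc = i.succ := Fin.exists_castSucc_eq.2 hit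
      have h1 : ds i'.castSucc < ds i'.succ := by
        have h2 := (hD.2.2 i').2.1
        rw [dim_succ hD hds i', hi', dim_succ hD hds i, ← hi'] at h2
        exact_mod_cast h2
      have h2 : ds i'.succ ≤ d := by
        rw [← ds_last hd hD hds]; exact ds_mono hD hds (Fin.le_last _)
      let l : Fin d := ⟨ds i'.castSucc, by omega⟩
      have h3 := tor_eq hd hD hds hg i' l h1 le_rfl
      rw [hi'] at h3
      rw [← h3] at hm ⊢
      refine hreg j l ?_ m hm
      change (j : ℕ) ≤ ds i'.castSucc
      rw [hi']
      exact hj.le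
  have hint := inter x (D i.succ) (ds i.succ) hnd hL
  have hw := weakReg x (D i.succ) (D i.castSucc) hEL (ds i.succ) hnd (by
    intro j hj m hm hxm
    have hpos : ds i.castSucc ≤ ds i.succ - 1 := by
      rcases hds i.castSucc with h | h
      · rw [h.2]; exact Nat.zero_le _
      · rw [h, dim_succ hD hds i] at hlt
        have h2 : ds i.castSucc < ds i.succ := by exact_mod_cast hlt
        omega
    let k : Fin d := ⟨ds i.succ - 1, by omega⟩
    have h3 := tor_eq hd hD hds hg i k (by change ds i.succ - 1 < ds i.succ; omega) hpos
    have h4 : x j • m ∈ JJ x j • (⊤ : Submodule R M) ⊔ D i.castSucc :=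
      mem_of_sup hxm (le_sup_of_le_left (smul_mono_right _ le_top)) le_sup_right
    have h5 : m ∈ JJ x j • (⊤ : Submodule R M) ⊔ D i.castSucc := by
      rw [← h3] at h4 ⊢
      refine hreg j k ?_ m h4
      change (j : ℕ) ≤ ds i.succ - 1
      omega
    obtain ⟨u, hu, e, he, rfl⟩ := Submodule.mem_sup.1 h5
    refine Submodule.add_mem_sup (hint j hj.le ⟨hu, ?_⟩) he
    have := sub_mem hm (hEL he)
    rwa [add_sub_cancel_right] at this)
  have hnt : Nontrivial (↥(D i.succ) ⧸ (D i.castSucc).comap (D i.succ).subtype) := by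
    rw [Submodule.Quotient.nontrivial_iff]
    intro h
    have h2 : D i.succ ≤ D i.castSucc := Submodule.comap_subtype_eq_top.1 h
    rw [le_antisymm hEL h2] at hlt
    exact lt_irrefl _ hlt
  refine cm_of _ ?_ hw ?_
  · intro r hr
    rw [List.mem_ofFn] at hr
    obtain ⟨l, rfl⟩ := hr
    exact hg.1.1 _
  · rw [List.length_ofFn]
    have h1 := dim_succ hD hds i
    unfold moduleDim at h1 ⊢
    rw [← Module.supportDim_eq_ringKrullDim_quotient_annihilator] at h1 ⊢
    rw [← h1]
    exact Module.supportDim_le_of_surjective _ (Submodule.mkQ_surjective _)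

end PDec

/-- If some good system of parameters of `M` has the property of parametric
decomposition, then `M` is sequentially Cohen-Macaulay. -/
theorem stmt_2 {R : Type*} [CommRing R] [IsLocalRing R] [IsNoetherianRing R]
    {M : Type*} [AddCommGroup M] [Module R M] [Module.Finite R M]
    {d t : ℕ} (hd : moduleDim R M = (d : WithBot ℕ∞))
    (D : Fin (t + 1) → Submodule R M) (hD : IsDimFiltration R M D)
    (ds : Fin (t + 1) → ℕ)
    (hds : ∀ i, (D i = ⊥ ∧ ds i = 0) ∨ moduleDim R ↥(D i) = (ds i : WithBot ℕ∞))
    (hex : ∃ x : Fin d → R, IsGoodSOP R M D ds x ∧ HasParamDecomp R M x) :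
    ∀ i : Fin t, IsCM R (↥(D i.succ) ⧸ (D i.castSucc).comap (D i.succ).subtype) := by
  obtain ⟨x, hg, hpd⟩ := hex
  exact fun i => PDec.main hd D hD ds hds x hg hpd i
end

section
/- Let (R, 𝔪) be a commutative Noetherian local ring and M a finitely generated R-module with dim M ≥ 2. Then the following are equivalent: (i) M/H^0_𝔪(M) is a Cohen-Macaulay module and 𝔪·H^0_𝔪(M) = 0; (ii) every system of parameters of M has the property of parametric decomposition. -/
open IsLocalRing

set_option linter.all false

namespace ParamDec

section ideals
variable {R : Type*} [CommRing R]

lemma sup_pow_le (A B : Ideal R) (n : ℕ) : (A ⊔ B) ^ n ≤ A ^ n ⊔ B := by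
  induction n with
  | zero => simp
  | succ n ih =>
    rw [pow_succ]
    refine (Ideal.mul_mono ih le_rfl).trans ?_
    rw [Ideal.sup_mul, Ideal.mul_sup, ← pow_succ]
    refine sup_le (sup_le le_sup_left ?_) ?_
    · exact Ideal.mul_le_right.trans le_sup_right
    · exact Ideal.mul_le_left.trans le_sup_right

lemma sup_pow_le' (A B : Ideal R) : ∀ s m l : ℕ, m + l = s →
    (A ⊔ B) ^ (s + 1) ≤ A ^ (m + 1) ⊔ B ^ (l + 1) := by
  intro s
  induction s with
  | zero =>
    intro m l h
    obtain rfl : m = 0 := by omega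
    obtain rfl : l = 0 := by omega
    simp
  | succ s ih =>
    intro m l h
    rcases Nat.eq_zero_or_pos m with rfl | hm
    · have := sup_pow_le B A (s + 1 + 1)
      obtain rfl : l = s + 1 := by omega
      rw [sup_comm A B, sup_comm (A ^ _)]
      simpa using this
    rcases Nat.eq_zero_or_pos l with rfl | hl
    · have := sup_pow_le A B (s + 1 + 1)
      obtain rfl : m = s + 1 := by omega
      simpa using this
    obtain ⟨m, rfl⟩ := Nat.exists_eq_succ_of_ne_zero hm.ne'
    obtain ⟨l, rfl⟩ := Nat.exists_eq_succ_of_ne_zero hl.ne'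
    rw [pow_succ', Ideal.sup_mul]
    refine sup_le ?_ ?_
    · refine (Ideal.mul_mono le_rfl (ih m (l + 1) (by omega))).trans ?_
      rw [Ideal.mul_sup, ← pow_succ']
      exact sup_le_sup le_rfl Ideal.mul_le_right
    · refine (Ideal.mul_mono le_rfl (ih (m + 1) l (by omega))).trans ?_
      rw [Ideal.mul_sup, ← pow_succ']
      exact sup_le_sup Ideal.mul_le_right le_rfl

lemma sup_pow_succ_le (A B : Ideal R) (n : ℕ) :
    (A ⊔ B) ^ (n + 1) ≤ A ^ (n + 1) ⊔ B * (A ⊔ B) ^ n := by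
  induction n with
  | zero => simp
  | succ n ih =>
    rw [pow_succ' _ (n + 1), Ideal.sup_mul]
    refine sup_le ?_ le_sup_right
    refine (Ideal.mul_mono le_rfl ih).trans ?_
    rw [Ideal.mul_sup, ← pow_succ']
    refine sup_le_sup le_rfl ?_
    rw [mul_left_comm, pow_succ' _ n]
    exact Ideal.mul_mono le_rfl (Ideal.mul_mono le_sup_left le_rfl)

/-- pigeonhole -/
lemma span_pow_le {ι : Type*} [DecidableEq ι] (x : ι → R) (T : Finset ι) (α : ι → ℕ)
    (n : ℕ) (h1 : ∀ i, 1 ≤ α i) (h : ∑ i ∈ T, (α i - 1) < n) :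
    Ideal.span (x '' (T : Set ι)) ^ n ≤ Ideal.span ((fun i => x i ^ α i) '' (T : Set ι)) := by
  induction T using Finset.induction_on generalizing n with
  | empty =>
    have : n ≠ 0 := by omega
    simp [this]
  | insert k T hk ih =>
    rw [Finset.sum_insert hk] at h
    simp only [Finset.coe_insert, Set.image_insert_eq, Ideal.span_insert]
    have h1k := h1 k
    obtain ⟨m, hm⟩ : ∃ m, n = (α k - 1 + m) + 1 := ⟨n - 1 - (α k - 1), by omega⟩
    rw [hm]
    refine (sup_pow_le' _ _ _ (α k - 1) m rfl).trans ?_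
    refine sup_le_sup ?_ (ih _ (by omega))
    rw [Ideal.span_singleton_pow]
    rw [Nat.sub_add_cancel h1k]

end ideals

section loc
variable {R : Type*} [CommRing R] [IsLocalRing R] [IsNoetherianRing R]
variable {M : Type*} [AddCommGroup M] [Module R M]

lemma exists_pow_le_of_primes (J : Ideal R)
    (h : ∀ P : Ideal R, P.IsPrime → J ≤ P → P = maximalIdeal R) :
    ∃ k : ℕ, maximalIdeal R ^ k ≤ J := by
  apply Ideal.exists_pow_le_of_le_radical_of_fg _ (IsNoetherian.noetherian _)
  rw [Ideal.radical_eq_sInf]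
  refine le_sInf ?_
  rintro P ⟨h1, h2⟩
  exact (h P h2 h1).ge

variable [Module.Finite R M]

/-- Krull intersection for a submodule. -/
lemma krull_mem (N : Submodule R M) (a : M)
    (h : ∀ s : ℕ, 1 ≤ s → a ∈ N ⊔ (maximalIdeal R ^ s) • (⊤ : Submodule R M)) : a ∈ N := by
  have h0 := Ideal.iInf_pow_smul_eq_bot_of_isLocalRing (M := M ⧸ N) (maximalIdeal R)
    (maximalIdeal.isMaximal R).ne_top
  rw [← Submodule.Quotient.mk_eq_zero, ← Submodule.mem_bot R, ← h0, Submodule.mem_iInf]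
  intro i
  have h1 := h (i + 1) (by omega)
  have h2 : Submodule.map N.mkQ (maximalIdeal R ^ (i + 1) • (⊤ : Submodule R M)) ≤
      maximalIdeal R ^ i • ⊤ := by
    rw [Submodule.map_smul'']
    exact Submodule.smul_mono (Ideal.pow_le_pow_right (by omega)) le_top
  obtain ⟨u, hu, v, hv, rfl⟩ := Submodule.mem_sup.1 h1
  rw [Submodule.Quotient.mk_add, (Submodule.Quotient.mk_eq_zero N).2 hu, zero_add]
  exact h2 (Submodule.mem_map_of_mem hv)

lemma mem_H0m (a : M) : a ∈ H0m R M ↔ ∃ n : ℕ, ∀ r ∈ maximalIdeal R ^ n, r • a = 0 := by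
  unfold H0m
  rw [Submodule.mem_iSup_of_directed]
  · simp [Submodule.mem_torsionBySet_iff]
  · refine Monotone.directed_le ?_
    intro i j hij
    exact Submodule.torsionBySet_le_torsionBySet_of_subset (Ideal.pow_le_pow_right hij)

lemma H0m_pow : ∃ n : ℕ, ∀ a ∈ H0m R M, ∀ r ∈ maximalIdeal R ^ n, r • a = 0 := by
  obtain ⟨s, hs⟩ := IsNoetherian.noetherian (H0m R M)
  have h : ∀ a ∈ s, ∃ n : ℕ, ∀ r ∈ maximalIdeal R ^ n, r • a = 0 := fun a ha =>
    (mem_H0m a).1 (hs ▸ Submodule.subset_span ha)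
  choose! f hf using h
  refine ⟨s.sup f, ?_⟩
  intro a ha r hr
  rw [← hs] at ha
  induction ha using Submodule.span_induction with
  | mem a ha => exact hf a ha r (Ideal.pow_le_pow_right (Finset.le_sup ha) hr)
  | zero => simp
  | add u v _ _ hu hv => rw [smul_add, hu, hv, add_zero]
  | smul c u _ hu => rw [smul_comm, hu, smul_zero]

/-- membership in H0m by primes -/
lemma mem_H0m_of_primes (a : M)
    (h : ∀ P : Ideal R, P.IsPrime → Module.annihilator R M ≤ P →
      (∀ r : R, r • a = 0 → r ∈ P) → P = maximalIdeal R) : a ∈ H0m R M := by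
  obtain ⟨k, hk⟩ := exists_pow_le_of_primes (LinearMap.ker (LinearMap.toSpanSingleton R M a)) (by
    intro P hP hle
    have h' : ∀ r : R, r • a = 0 → r ∈ P := fun r hr => hle (by simpa using hr)
    exact h P hP (fun r hr => h' r (Module.mem_annihilator.1 hr a)) h')
  rw [mem_H0m]
  exact ⟨k, fun r hr => by simpa using hk hr⟩

/-- finite length criterion -/
lemma finiteLength_iff (I : Ideal R) (hI : I ≤ maximalIdeal R) :
    IsFiniteLength R (M ⧸ I • (⊤ : Submodule R M)) ↔
    ∀ P : Ideal R, P.IsPrime → Module.annihilator R M ≤ P → I ≤ P → P = maximalIdeal R := by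
  have key : ∀ P : Ideal R, P.IsPrime →
      (Module.annihilator R (M ⧸ I • (⊤ : Submodule R M)) ≤ P ↔
        Module.annihilator R M ≤ P ∧ I ≤ P) := by
    intro P hP
    have h1 := Module.support_quotient (M := M) I
    rw [Module.support_eq_zeroLocus, Module.support_eq_zeroLocus] at h1
    have := Set.ext_iff.1 h1 ⟨P, hP⟩
    simpa using this
  constructor
  · intro h P hP h1 h2
    have hann := (key P hP).2 ⟨h1, h2⟩
    set N := M ⧸ I • (⊤ : Submodule R M)
    obtain ⟨_, hA⟩ := isFiniteLength_iff_isNoetherian_isArtinian.1 h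
    obtain ⟨n, hn⟩ := IsArtinian.monotone_stabilizes (R := R) (M := N)
      ⟨fun k => OrderDual.toDual ((maximalIdeal R) ^ k • (⊤ : Submodule R N)), by
        intro i j hij
        exact Submodule.smul_mono (Ideal.pow_le_pow_right hij) le_rfl⟩
    have h3 : (maximalIdeal R) ^ n • (⊤ : Submodule R N) =
        (maximalIdeal R) ^ (n + 1) • (⊤ : Submodule R N) := hn (n + 1) (by omega)
    have h4 : (maximalIdeal R) ^ n • (⊤ : Submodule R N) = ⊥ := by
      apply Submodule.eq_bot_of_le_smul_of_le_jacobson_bot (maximalIdeal R) _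
        (IsNoetherian.noetherian _) _ (maximalIdeal_le_jacobson _)
      rw [← mul_smul, ← pow_succ']
      exact h3.le
    have h5 : maximalIdeal R ^ n ≤ P := by
      refine le_trans ?_ hann
      intro r hr
      rw [Module.mem_annihilator]
      intro m
      rw [← Submodule.mem_bot R, ← h4]
      exact Submodule.smul_mem_smul hr trivial
    have h6 : maximalIdeal R ≤ P := Ideal.IsPrime.le_of_pow_le h5
    exact le_antisymm (le_maximalIdeal hP.ne_top) h6
  · intro h
    set N := M ⧸ I • (⊤ : Submodule R M)
    rw [isFiniteLength_iff_isNoetherian_isArtinian]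
    refine ⟨inferInstance, ?_⟩
    by_cases htop : Module.annihilator R N = ⊤
    · have : Subsingleton N := Module.annihilator_eq_top_iff.1 htop
      infer_instance
    have hm : maximalIdeal R ∈ (Module.annihilator R N).minimalPrimes := by
      refine ⟨⟨inferInstance, le_maximalIdeal htop⟩, ?_⟩
      rintro P ⟨hP, hle⟩ _
      exact (h P hP ((key P hP).1 hle).1 ((key P hP).1 hle).2).ge
    have := quotient_artinian_of_mem_minimalPrimes_of_isLocalRing _ hm
    letI : Module (R ⧸ Module.annihilator R N) N := Module.quotientAnnihilator
    haveI : IsScalarTower R (R ⧸ Module.annihilator R N) N :=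
      Module.IsTorsionBySet.isScalarTower _
    have : Module.Finite (R ⧸ Module.annihilator R N) N := Module.Finite.of_restrictScalars_finite R _ _
    have : IsArtinian (R ⧸ Module.annihilator R N) N := inferInstance
    exact isArtinian_of_surjective_algebraMap (R := R ⧸ Module.annihilator R N)
      Ideal.Quotient.mk_surjective

lemma isSOP_iff {d : ℕ} (x : Fin d → R) : IsSOP R M x ↔ (∀ i, x i ∈ maximalIdeal R) ∧
    ∀ P : Ideal R, P.IsPrime → Module.annihilator R M ≤ P → (∀ i, x i ∈ P) →
      P = maximalIdeal R := by
  unfold IsSOP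
  refine and_congr_right fun hx => ?_
  rw [finiteLength_iff _ (Ideal.span_le.2 (by rintro _ ⟨i, rfl⟩; exact hx i))]
  refine forall_congr' fun P => forall_congr' fun hP => forall_congr' fun hle => ?_
  rw [Ideal.span_le, Set.range_subset_iff]
  rfl

/-- powers of a sop -/
lemma isSOP_pow {d : ℕ} {x : Fin d → R} (hx : IsSOP R M x) (e : Fin d → ℕ) (he : ∀ i, 1 ≤ e i) :
    IsSOP R M (fun i => x i ^ e i) := by
  rw [isSOP_iff] at hx ⊢
  refine ⟨fun i => Ideal.pow_mem_of_mem _ (hx.1 i) _ (he i), fun P hP h1 h2 => ?_⟩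
  exact hx.2 P hP h1 fun i => hP.mem_of_pow_mem _ (h2 i)

lemma isSOP_add {d : ℕ} {x : Fin d → R} (hx : IsSOP R M x) (i j : Fin d) (hij : i ≠ j) :
    IsSOP R M (Function.update x i (x i + x j)) := by
  rw [isSOP_iff] at hx ⊢
  refine ⟨fun l => ?_, fun P hP h1 h2 => hx.2 P hP h1 ?_⟩
  · by_cases h : l = i
    · subst h; simpa using Ideal.add_mem _ (hx.1 l) (hx.1 j)
    · simpa [h] using hx.1 l
  · have hj : x j ∈ P := by simpa [hij.symm] using h2 j
    intro l
    by_cases h : l = i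
    · subst h
      have : x l + x j ∈ P := by simpa using h2 l
      simpa using Ideal.sub_mem _ this hj
    · simpa [h] using h2 l

lemma exists_sop {d : ℕ} (hd : moduleDim R M = (d : WithBot ℕ∞)) :
    ∃ x : Fin d → R, IsSOP R M x := by
  have hne : Module.annihilator R M ≠ ⊤ := by
    intro h
    have : Subsingleton (R ⧸ Module.annihilator R M) := by
      rw [h]; exact Ideal.Quotient.subsingleton_iff.2 rfl
    unfold moduleDim at hd
    rw [ringKrullDim_eq_bot_of_subsingleton] at hd
    exact WithBot.bot_ne_coe hd
  set A := R ⧸ Module.annihilator R M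
  have : Nontrivial A := Ideal.Quotient.nontrivial_iff.2 hne
  have : IsLocalRing A := IsLocalRing.of_surjective' (Ideal.Quotient.mk _) Ideal.Quotient.mk_surjective
  obtain ⟨s, hs, hc⟩ := Ideal.exists_finset_card_eq_height_of_isNoetherianRing (maximalIdeal A)
  have hcd : s.card = d := by
    have := IsLocalRing.maximalIdeal_height_eq_ringKrullDim (R := A)
    rw [← hc, show ringKrullDim A = d from hd] at this
    exact_mod_cast this
  subst hcd
  choose f hf using (Ideal.Quotient.mk_surjective (I := Module.annihilator R M))
  have hloc : IsLocalHom (Ideal.Quotient.mk (Module.annihilator R M)) :=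
    IsLocalHom.of_surjective _ Ideal.Quotient.mk_surjective
  refine ⟨fun i => f (s.equivFin.symm i), isSOP_iff _ |>.2 ⟨?_, ?_⟩⟩
  · intro i
    have h1 : ((s.equivFin.symm i : s) : A) ∈ maximalIdeal A :=
      hs.1.2 (Ideal.subset_span (s.equivFin.symm i).2)
    rw [mem_maximalIdeal, mem_nonunits_iff] at h1 ⊢
    intro h
    apply h1
    rw [← hf (s.equivFin.symm i)]
    exact h.map _
  · intro P hP hle hi
    have hP' : (P.map (Ideal.Quotient.mk (Module.annihilator R M))).IsPrime :=
      Ideal.isPrime_map_quotientMk_of_isPrime hle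
    have h2 : maximalIdeal A ≤ P.map (Ideal.Quotient.mk (Module.annihilator R M)) := by
      refine hs.2 ⟨hP', ?_⟩ (le_maximalIdeal hP'.ne_top)
      rw [Ideal.span_le]
      intro a ha
      have := hi (s.equivFin ⟨a, ha⟩)
      simp only [Equiv.symm_apply_apply] at this
      rw [← hf a]
      exact Ideal.mem_map_of_mem _ this
    refine le_antisymm (le_maximalIdeal hP.ne_top) ?_
    intro r hr
    have h3 : Ideal.Quotient.mk (Module.annihilator R M) r ∈ maximalIdeal A := by
      rw [mem_maximalIdeal, mem_nonunits_iff] at hr ⊢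
      intro h
      exact hr (isUnit_of_map_unit _ _ h)
    have h4 := Ideal.mem_comap.2 (h2 h3)
    rwa [Ideal.comap_map_of_surjective' _ Ideal.Quotient.mk_surjective, Ideal.mk_ker,
      sup_eq_left.2 hle] at h4

end loc
end ParamDec

namespace ParamDec

section s2
variable {R : Type*} [CommRing R] [IsLocalRing R] [IsNoetherianRing R]
variable {M : Type*} [AddCommGroup M] [Module R M] [Module.Finite R M]

lemma mem_span_smul (r : R) (N : Submodule R M) (m : M) :
    m ∈ Ideal.span {r} • N ↔ ∃ n ∈ N, r • n = m := by
  rw [Submodule.ideal_span_singleton_smul, Submodule.mem_smul_pointwise_iff_exists]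

lemma Lambda_sum {d n : ℕ} (hn : 1 ≤ n) {α : Fin d → ℕ} (h : α ∈ Lambda d n) :
    ∑ i, (α i - 1) = n - 1 := by
  obtain ⟨h1, h2⟩ := h
  have : ∑ i, α i = ∑ i, (α i - 1) + d := by
    have h3 : ∀ i, α i = (α i - 1) + 1 := fun i => by have := h1 i; omega
    calc ∑ i, α i = ∑ i, ((α i - 1) + 1) := Finset.sum_congr rfl fun i _ => h3 i
      _ = _ := by simp [Finset.sum_add_distrib]
  omega

variable {d : ℕ}

lemma step1 (hPD : ∀ x : Fin d → R, IsSOP R M x → HasParamDecomp R M x) {x : Fin d → R}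
    (hx : IsSOP R M x) {i j : Fin d} (hij : i ≠ j) {a : M} (ha : x i • a = 0) :
    x j • a ∈ (Ideal.span (Set.range x)) ^ 2 • (⊤ : Submodule R M) := by
  set y := Function.update x i (x i + x j) with hy
  have hyi : y i = x i + x j := by simp [hy]
  have hyl : ∀ l, l ≠ i → y l = x l := fun l hl => by simp [hy, hl]
  have h := hPD y (isSOP_add hx i j hij) 2 (by omega)
  have h1 : x j • a ∈ (Ideal.span (Set.range y)) ^ 2 • (⊤ : Submodule R M) := by
    rw [h]
    simp only [Submodule.mem_iInf]
    intro α hα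
    have hs := Lambda_sum (by omega) hα
    have hle := Finset.add_le_sum (f := fun l => α l - 1) (s := Finset.univ)
      (fun _ _ => Nat.zero_le _) (Finset.mem_univ i) (Finset.mem_univ j) hij
    have hi := hα.1 i
    have hj := hα.1 j
    by_cases h1 : α i = 1
    · have : x j • a = (y i ^ α i) • a := by rw [h1, pow_one, hyi, add_smul, ha, zero_add]
      rw [this]
      exact Submodule.smul_mem_smul (Ideal.subset_span ⟨i, rfl⟩) trivial
    · have h2 : α j = 1 := by omega
      have : x j • a = (y j ^ α j) • a := by rw [h2, pow_one, hyl j hij.symm]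
      rw [this]
      exact Submodule.smul_mem_smul (Ideal.subset_span ⟨j, rfl⟩) trivial
  refine Submodule.smul_mono (Ideal.pow_right_mono ?_ 2) le_rfl h1
  rw [Ideal.span_le]
  rintro _ ⟨l, rfl⟩
  by_cases hl : l = i
  · subst hl
    rw [hyi]
    exact Ideal.add_mem _ (Ideal.subset_span ⟨l, rfl⟩) (Ideal.subset_span ⟨j, rfl⟩)
  · rw [hyl l hl]
    exact Ideal.subset_span ⟨l, rfl⟩

lemma step1' (hPD : ∀ x : Fin d → R, IsSOP R M x → HasParamDecomp R M x) {x : Fin d → R}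
    (hx : IsSOP R M x) {i j : Fin d} (hij : i ≠ j) {a : M} (ha : x i • a = 0) :
    ∃ b : M, x j • a = x j ^ 2 • b := by
  suffices h : x j • a ∈ Ideal.span {x j ^ 2} • (⊤ : Submodule R M) by
    obtain ⟨b, _, hb⟩ := (mem_span_smul _ _ _).1 h
    exact ⟨b, hb.symm⟩
  apply krull_mem
  intro s hs
  have h1 := step1 hPD (isSOP_pow hx (fun l => if l = j then 1 else s)
    (fun l => by split_ifs <;> omega)) hij (a := a) (by
      simp only [hij, if_false]
      obtain ⟨s, rfl⟩ := Nat.exists_eq_succ_of_ne_zero (by omega : s ≠ 0)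
      rw [pow_succ, mul_smul, ha, smul_zero])
  simp only [if_true, pow_one] at h1
  have h2 : Ideal.span (Set.range fun l => x l ^ (if l = j then 1 else s)) ≤
      Ideal.span {x j} ⊔ maximalIdeal R ^ s := by
    rw [Ideal.span_le]
    rintro _ ⟨l, rfl⟩
    by_cases hl : l = j
    · subst hl
      simp only [if_true, pow_one]
      exact Submodule.mem_sup_left (Ideal.mem_span_singleton_self _)
    · simp only [hl, if_false]
      exact Submodule.mem_sup_right (Ideal.pow_mem_pow (hx.1 l) _)
  have h3 := (Ideal.pow_right_mono h2 2).trans (sup_pow_le _ _ _)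
  rw [Ideal.span_singleton_pow] at h3
  rw [← Submodule.sup_smul]
  exact Submodule.smul_mono h3 le_rfl h1

lemma step2 (hPD : ∀ x : Fin d → R, IsSOP R M x → HasParamDecomp R M x) {x : Fin d → R}
    (hx : IsSOP R M x) {i : Fin d} {a : M} (ha : x i • a = 0) : a ∈ H0m R M := by
  have key : ∀ j, ∃ k, x j ^ k • a = 0 := by
    intro j
    by_cases hij : i = j
    · subst hij
      exact ⟨1, by simpa using ha⟩
    obtain ⟨k, hk⟩ := Ideal.exists_pow_inf_eq_pow_smul (Ideal.span {x j}) (Submodule.span R {a})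
    refine ⟨k + 1, ?_⟩
    obtain ⟨b, hb⟩ := step1' hPD (isSOP_pow hx (fun _ => k + 1) (by simp)) hij (a := a)
      (by rw [pow_succ, mul_smul, ha, smul_zero])
    have h1 : x j ^ (k + 1) • a ∈
        Ideal.span {x j} ^ ((k + 1) * 2) • (⊤ : Submodule R M) ⊓ Submodule.span R {a} := by
      refine ⟨?_, Submodule.smul_mem _ _ (Submodule.mem_span_singleton_self _)⟩
      rw [hb, ← pow_mul, Ideal.span_singleton_pow]
      exact Submodule.smul_mem_smul (Ideal.mem_span_singleton_self _) trivial
    rw [hk _ (by omega)] at h1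
    have h2 := Submodule.smul_mono (Ideal.pow_le_pow_right (by omega : k + 2 ≤ (k + 1) * 2 - k))
      inf_le_right h1
    rw [Ideal.span_singleton_pow, mem_span_smul] at h2
    obtain ⟨n, hn, h3⟩ := h2
    obtain ⟨r, rfl⟩ := Submodule.mem_span_singleton.1 hn
    have hu : IsUnit (1 - x j * r) := by
      apply isUnit_one_sub_self_of_mem_nonunits
      exact Ideal.mul_mem_right _ _ (hx.1 j)
    rw [← hu.smul_eq_zero (x := x j ^ (k + 1) • a), sub_smul, one_smul, ← h3]
    simp only [← mul_smul, ← sub_smul]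
    have : x j ^ (k + 2) * r - x j * r * (x j ^ (k + 2) * r) =
      (1 - x j * r) * (x j ^ (k + 2) * r) := by ring
    have e : (x j ^ (k+2) * r) • a = x j ^ (k + 1) • a := by rw [mul_smul, h3]
    rw [sub_smul, e, mul_smul, e, ← mul_smul]
    rw [← e, ← sub_smul]
    convert zero_smul R a using 2
    ring
  choose f hf using key
  apply mem_H0m_of_primes
  intro P hP h1 h2
  refine ((isSOP_iff x).1 hx).2 P hP h1 fun l => ?_
  exact hP.mem_of_pow_mem _ (h2 _ (hf l))

lemma step3a (hPD : ∀ x : Fin d → R, IsSOP R M x → HasParamDecomp R M x) {x : Fin d → R}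
    (hx : IsSOP R M x) {j : Fin d} {b : M} (hb : x j • b ∈ H0m R M) : b ∈ H0m R M := by
  obtain ⟨n, hn⟩ := (mem_H0m _).1 hb
  refine step2 hPD (isSOP_pow hx (fun _ => n + 1) (by simp)) (i := j) ?_
  rw [pow_succ, mul_smul]
  exact hn _ (Ideal.pow_mem_pow (hx.1 j) _)

lemma step3 (h2 : 2 ≤ d) (hPD : ∀ x : Fin d → R, IsSOP R M x → HasParamDecomp R M x)
    {x : Fin d → R} (hx : IsSOP R M x) (j : Fin d) {a : M} (ha : a ∈ H0m R M) : x j • a = 0 := by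
  have : Nontrivial (Fin d) := Fin.nontrivial_iff_two_le.2 h2
  obtain ⟨i, hij⟩ := exists_ne j
  have key : Ideal.span {x j} • H0m R M = ⊥ := by
    apply Submodule.eq_bot_of_le_smul_of_le_jacobson_bot (Ideal.span {x j}) _
      (IsNoetherian.noetherian _)
    · intro m hm
      obtain ⟨a, ha, rfl⟩ := (mem_span_smul _ _ _).1 hm
      obtain ⟨n, hn⟩ := (mem_H0m _).1 ha
      obtain ⟨b, hb⟩ := step1' hPD (isSOP_pow hx (fun l => if l = j then 1 else n + 1)
        (fun l => by split_ifs <;> omega)) hij (a := a) (by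
          simp only [hij, if_false]
          exact hn _ (Ideal.pow_le_pow_right (by omega) (Ideal.pow_mem_pow (hx.1 i) _)))
      simp only [if_true, pow_one] at hb
      have h3 : a - x j • b ∈ H0m R M := by
        apply step2 hPD hx (i := j)
        rw [smul_sub, hb, pow_two, mul_smul, sub_self]
      have h4 : b ∈ H0m R M := by
        apply step3a hPD hx (j := j)
        simpa using Submodule.sub_mem _ ha h3
      refine (mem_span_smul _ _ _).2 ⟨x j • b, (mem_span_smul _ _ _).2 ⟨b, h4, rfl⟩, ?_⟩
      rw [hb, pow_two, mul_smul]
    · refine le_trans ?_ (maximalIdeal_le_jacobson _)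
      rw [Ideal.span_le]
      simpa using hx.1 j
  rw [← Submodule.mem_bot R, ← key]
  exact Submodule.smul_mem_smul (Ideal.mem_span_singleton_self _) ha

lemma chain_false {p Q m : Ideal R} {x : R} [p.IsPrime] [Q.IsPrime]
    (h1 : p < Q) (h2 : Q < m) (hm : m ∈ (p ⊔ Ideal.span {x}).minimalPrimes) : False := by
  have hmp : m.IsPrime := hm.1.1
  have h := Ideal.map_height_le_one_of_mem_minimalPrimes hm
  have e1 : (m.map (Ideal.Quotient.mk p)).IsPrime :=
    Ideal.isPrime_map_quotientMk_of_isPrime (h1.le.trans h2.le)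
  have e2 : (Q.map (Ideal.Quotient.mk p)).IsPrime :=
    Ideal.isPrime_map_quotientMk_of_isPrime h1.le
  have c : ∀ J : Ideal R, p ≤ J → (J.map (Ideal.Quotient.mk p)).comap (Ideal.Quotient.mk p) = J := by
    intro J hJ
    rw [Ideal.comap_map_of_surjective' _ Ideal.Quotient.mk_surjective, Ideal.mk_ker,
      sup_eq_left.2 hJ]
  have l1 : Q.map (Ideal.Quotient.mk p) < m.map (Ideal.Quotient.mk p) := by
    refine lt_of_le_of_ne (Ideal.map_mono h2.le) fun he => h2.ne ?_
    rw [← c Q h1.le, he, c m (h1.le.trans h2.le)]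
  have l2 : ⊥ < Q.map (Ideal.Quotient.mk p) := by
    refine lt_of_le_of_ne bot_le fun he => h1.ne ?_
    rw [← c Q h1.le, ← he]
    exact Ideal.mk_ker.symm
  have h3 := (Ideal.height_le_iff (n := 1)).1 (by exact_mod_cast h) _ e2 l1
  have h4 : (Q.map (Ideal.Quotient.mk p)).height ≤ (0 : ℕ) := by
    simpa using h3
  have h5 := (Ideal.height_le_iff (n := 0)).1 h4 ⊥ Ideal.isPrime_bot l2
  simp at h5

lemma avoid {x : Fin d → R} (hx : IsSOP R M x) (k : Fin d) {z : R} (hz : z ∈ maximalIdeal R) :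
    ∃ s, 1 ≤ s ∧ IsSOP R M (Function.update x k (z + x k ^ s)) := by
  have hx' := (isSOP_iff x).1 hx
  set I := Ideal.span (x '' {l | l ≠ k}) ⊔ Module.annihilator R M with hI
  have hfin := Ideal.finite_minimalPrimes_of_isNoetherianRing R I
  have hk : ∀ p : Ideal R, p.IsPrime → I ≤ p → x k ∈ p → p = maximalIdeal R := by
    intro p hp hle hk
    refine hx'.2 p hp (le_sup_right.trans hle) fun l => ?_
    by_cases hl : l = k
    · rwa [hl]
    · exact hle (Submodule.mem_sup_left (Ideal.subset_span ⟨l, hl, rfl⟩))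
  have hS : (⋃ p ∈ I.minimalPrimes, {s : ℕ | 1 ≤ s ∧ z + x k ^ s ∈ p ∧ p ≠ maximalIdeal R}).Finite := by
    refine hfin.biUnion fun p hp => Set.Subsingleton.finite ?_
    have hpp : p.IsPrime := hp.1.1
    have aux : ∀ s t, s < t → z + x k ^ s ∈ p → z + x k ^ t ∈ p → p = maximalIdeal R := by
      intro s t hst h1 h2
      have h3 := Ideal.sub_mem _ h1 h2
      obtain ⟨e, rfl⟩ := Nat.exists_eq_add_of_lt hst
      have h4 : x k ^ s * (1 - x k ^ (e + 1)) ∈ p := by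
        convert h3 using 1; ring
      have hu : IsUnit (1 - x k ^ (e + 1)) := by
        apply isUnit_one_sub_self_of_mem_nonunits
        exact Ideal.pow_mem_of_mem _ (hx.1 k) _ (by omega)
      rcases hpp.mem_or_mem h4 with h5 | h5
      · exact hk p hpp hp.1.2 (hpp.mem_of_pow_mem _ h5)
      · exact absurd (Ideal.eq_top_of_isUnit_mem _ h5 hu) hpp.ne_top
    rintro s ⟨_, hs, hpm⟩ t ⟨_, ht, _⟩
    rcases lt_trichotomy s t with h | h | h
    · exact absurd (aux s t h hs ht) hpm
    · exact h
    · exact absurd (aux t s h ht hs) hpm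
  obtain ⟨s, hs, hsn⟩ := (Set.Ici_infinite (1 : ℕ)).exists_notMem_finite hS
  refine ⟨s, hs, (isSOP_iff _).2 ⟨?_, ?_⟩⟩
  · intro l
    by_cases hl : l = k
    · subst hl
      simpa using Ideal.add_mem _ hz (Ideal.pow_mem_of_mem _ (hx.1 l) s hs)
    · simpa [hl] using hx.1 l
  · intro Q hQ hann hmem
    have hIQ : I ≤ Q := by
      refine sup_le ?_ hann
      rw [Ideal.span_le]
      rintro _ ⟨l, hl, rfl⟩
      have hl' : l ≠ k := hl
      simpa [hl'] using hmem l
    have hzQ : z + x k ^ s ∈ Q := by simpa using hmem k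
    obtain ⟨p, hp, hpQ⟩ := Ideal.exists_minimalPrimes_le hIQ
    have hpp : p.IsPrime := hp.1.1
    by_cases hpm : p = maximalIdeal R
    · exact le_antisymm (le_maximalIdeal hQ.ne_top) (hpm ▸ hpQ)
    by_contra hQm
    have hne : p ≠ Q := by
      rintro rfl
      exact hsn (Set.mem_biUnion hp ⟨hs, hzQ, hpm⟩)
    refine chain_false (lt_of_le_of_ne hpQ hne)
      (lt_of_le_of_ne (le_maximalIdeal hQ.ne_top) hQm) (x := x k) ⟨⟨inferInstance, ?_⟩, ?_⟩
    · refine sup_le (le_maximalIdeal hpp.ne_top) ?_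
      rw [Ideal.span_le]
      simpa using hx.1 k
    · rintro P ⟨hP, hle⟩ _
      refine (hk P hP (hp.1.2.trans (le_sup_left.trans hle)) ?_).ge
      exact hle (Submodule.mem_sup_right (Ideal.mem_span_singleton_self _))

lemma step4 (hd : moduleDim R M = (d : WithBot ℕ∞)) (h2 : 2 ≤ d)
    (hPD : ∀ x : Fin d → R, IsSOP R M x → HasParamDecomp R M x) :
    maximalIdeal R • H0m R M = ⊥ := by
  obtain ⟨x, hx⟩ := exists_sop hd
  rw [eq_bot_iff, Submodule.smul_le]
  intro z hz a ha
  let k : Fin d := ⟨0, by omega⟩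
  obtain ⟨s, hs, hy⟩ := avoid hx k hz
  have e1 := step3 h2 hPD hy k ha
  have e2 := step3 h2 hPD (isSOP_pow hx (fun _ => s) (fun _ => hs)) k ha
  simp only [Function.update_self, add_smul, e2, add_zero] at e1
  simpa using e1

end s2
end ParamDec

namespace ParamDec

section s3
variable {R : Type*} [CommRing R] [IsLocalRing R] [IsNoetherianRing R]
variable {M : Type*} [AddCommGroup M] [Module R M] [Module.Finite R M]
variable {d : ℕ}

lemma s5a (hPD : ∀ x : Fin d → R, IsSOP R M x → HasParamDecomp R M x) {x : Fin d → R}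
    (hx : IsSOP R M x) {T : Finset (Fin d)} {k : Fin d} (hk : k ∉ T) {n : ℕ} (hn : 1 ≤ n) {a : M}
    (ha : x k • a ∈ Ideal.span (x '' (T : Set (Fin d))) ^ n • (⊤ : Submodule R M)) :
    x k • a ∈ (Ideal.span (Set.range x)) ^ (n + 1) • (⊤ : Submodule R M) := by
  rw [hPD x hx (n + 1) (by omega)]
  simp only [Submodule.mem_iInf]
  intro α hα
  have hs := Lambda_sum (by omega) hα
  by_cases h1 : α k = 1
  · have : x k • a = (x k ^ α k) • a := by rw [h1, pow_one]
    rw [this]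
    exact Submodule.smul_mem_smul (Ideal.subset_span ⟨k, rfl⟩) trivial
  · have hle : ∑ i ∈ insert k T, (α i - 1) ≤ ∑ i, (α i - 1) :=
      Finset.sum_le_sum_of_subset (Finset.subset_univ _)
    rw [Finset.sum_insert hk] at hle
    have := hα.1 k
    refine Submodule.smul_mono ((span_pow_le x T α n hα.1 (by omega)).trans ?_) le_rfl ha
    exact Ideal.span_mono (Set.image_subset_range _ _)

lemma s5a' (hPD : ∀ x : Fin d → R, IsSOP R M x → HasParamDecomp R M x) {x : Fin d → R}
    (hx : IsSOP R M x) {T : Finset (Fin d)} {k : Fin d} (hk : k ∉ T) {n : ℕ} (hn : 1 ≤ n) {a : M}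
    (ha : x k • a ∈ Ideal.span (x '' (T : Set (Fin d))) ^ n • (⊤ : Submodule R M)) :
    x k • a ∈ (Ideal.span (x '' (T : Set (Fin d))) ⊔ Ideal.span {x k}) ^ (n + 1) •
      (⊤ : Submodule R M) := by
  apply krull_mem
  intro s hs
  set y : Fin d → R := fun l => x l ^ (if l ∈ T ∨ l = k then 1 else s) with hy
  have hyT : y '' (T : Set (Fin d)) = x '' (T : Set (Fin d)) := by
    apply Set.image_congr
    intro l hl
    have hl' : l ∈ T := hl
    simp [hy, hl']
  have hyk : y k = x k := by simp [hy]
  have h1 := s5a hPD (x := y) (isSOP_pow hx _ (fun l => by split_ifs <;> omega)) hk hn (a := a) (by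
    rw [hyT, hyk]; exact ha)
  rw [hyk] at h1
  have h2 : Ideal.span (Set.range y) ≤
      (Ideal.span (x '' (T : Set (Fin d))) ⊔ Ideal.span {x k}) ⊔ maximalIdeal R ^ s := by
    rw [Ideal.span_le]
    rintro _ ⟨l, rfl⟩
    by_cases hl : l = k
    · subst hl
      rw [hyk]
      exact Submodule.mem_sup_left (Submodule.mem_sup_right (Ideal.mem_span_singleton_self _))
    by_cases hl2 : l ∈ T
    · refine Submodule.mem_sup_left (Submodule.mem_sup_left (Ideal.subset_span ?_))
      rw [← hyT]
      exact ⟨l, hl2, rfl⟩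
    · simp only [hy, hl, hl2, or_self, if_false]
      exact Submodule.mem_sup_right (Ideal.pow_mem_pow (hx.1 l) _)
  have h3 := (Ideal.pow_right_mono h2 (n + 1)).trans (sup_pow_le _ _ _)
  rw [← Submodule.sup_smul]
  exact Submodule.smul_mono h3 le_rfl h1

lemma s5b (hPD : ∀ x : Fin d → R, IsSOP R M x → HasParamDecomp R M x) {x : Fin d → R}
    (hx : IsSOP R M x) {T : Finset (Fin d)} {k : Fin d} (hk : k ∉ T) {a : M}
    (ha : x k • a ∈ Ideal.span (x '' (T : Set (Fin d))) • (⊤ : Submodule R M)) (n : ℕ) :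
    ∃ v : M, x k • v ∈ Ideal.span (x '' (T : Set (Fin d))) ^ (n + 1) • (⊤ : Submodule R M) ∧
      a - v ∈ (Ideal.span (x '' (T : Set (Fin d))) ⊔ Ideal.span {x k}) • (⊤ : Submodule R M) := by
  induction n with
  | zero => exact ⟨a, by simpa using ha, by simp⟩
  | succ n ih =>
    obtain ⟨v, hv, hav⟩ := ih
    have h1 := s5a' hPD hx hk (by omega) hv
    have h2 := Submodule.smul_mono (sup_pow_succ_le _ _ _) le_rfl h1
    rw [Submodule.sup_smul, mul_smul] at h2
    obtain ⟨u, hu, w, hw, huw⟩ := Submodule.mem_sup.1 h2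
    obtain ⟨w, hw', rfl⟩ := (mem_span_smul _ _ _).1 hw
    refine ⟨v - w, ?_, ?_⟩
    · rw [smul_sub, ← huw, add_sub_cancel_right]
      exact hu
    · have : a - (v - w) = (a - v) + w := by abel
      rw [this]
      refine Submodule.add_mem _ hav ?_
      refine Submodule.smul_mono (Ideal.pow_le_self (by omega)) le_rfl hw'

lemma s5c (hPD : ∀ x : Fin d → R, IsSOP R M x → HasParamDecomp R M x) {x : Fin d → R}
    (hx : IsSOP R M x) {T : Finset (Fin d)} {k : Fin d} (hk : k ∉ T) {a : M}
    (ha : x k • a ∈ Ideal.span (x '' (T : Set (Fin d))) • (⊤ : Submodule R M)) :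
    a ∈ (Ideal.span (x '' (T : Set (Fin d))) ⊔ Ideal.span {x k}) • (⊤ : Submodule R M)
      ⊔ H0m R M := by
  set Q := Ideal.span (x '' (T : Set (Fin d)))
  obtain ⟨c, hc⟩ := Ideal.exists_pow_inf_eq_pow_smul Q (Ideal.span {x k} • (⊤ : Submodule R M))
  obtain ⟨v, hv, hav⟩ := s5b hPD hx hk ha c
  have h1 : x k • v ∈ Q ^ (c + 1) • (⊤ : Submodule R M) ⊓ (Ideal.span {x k} • (⊤ : Submodule R M)) :=
    ⟨hv, Submodule.smul_mem_smul (Ideal.mem_span_singleton_self _) trivial⟩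
  rw [hc _ (by omega)] at h1
  have h2 : x k • v ∈ Ideal.span {x k} • (Q • (⊤ : Submodule R M)) := by
    rw [← mul_smul, mul_comm, mul_smul]
    refine Submodule.smul_mono (Ideal.pow_le_self (by omega)) inf_le_right h1
  obtain ⟨u, hu, huv⟩ := (mem_span_smul _ _ _).1 h2
  have h3 : v - u ∈ H0m R M := by
    apply step2 hPD hx (i := k)
    rw [smul_sub, huv, sub_self]
  have : a = ((a - v) + u) + (v - u) := by abel
  rw [this]
  refine Submodule.add_mem_sup (Submodule.add_mem _ hav ?_) h3
  exact Submodule.smul_mono le_sup_left le_rfl hu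

lemma s5d (hPD : ∀ x : Fin d → R, IsSOP R M x → HasParamDecomp R M x) {x : Fin d → R}
    (hx : IsSOP R M x) {T : Finset (Fin d)} {k : Fin d} (hk : k ∉ T) {a : M}
    (ha : x k • a ∈ Ideal.span (x '' (T : Set (Fin d))) • (⊤ : Submodule R M)) :
    a ∈ Ideal.span (x '' (T : Set (Fin d))) • (⊤ : Submodule R M) ⊔ H0m R M := by
  apply krull_mem
  intro s hs
  set y : Fin d → R := fun l => x l ^ (if l = k then s else 1) with hy
  have hyT : y '' (T : Set (Fin d)) = x '' (T : Set (Fin d)) := by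
    apply Set.image_congr
    intro l hl
    have hl' : l ≠ k := by rintro rfl; exact hk hl
    simp [hy, hl']
  have hyk : y k = x k ^ s := by simp [hy]
  have h1 := s5c hPD (x := y) (isSOP_pow hx _ (fun l => by split_ifs <;> omega)) hk (a := a) (by
    rw [hyT, hyk]
    obtain ⟨s, rfl⟩ := Nat.exists_eq_succ_of_ne_zero (by omega : s ≠ 0)
    rw [pow_succ, mul_smul]
    exact Submodule.smul_mem _ _ ha)
  rw [hyT, hyk, Submodule.sup_smul] at h1
  rw [sup_right_comm]
  have h3 : Ideal.span {x k ^ s} • (⊤ : Submodule R M) ≤ maximalIdeal R ^ s • ⊤ := by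
    refine Submodule.smul_mono ?_ le_rfl
    rw [Ideal.span_le]
    simpa using Ideal.pow_mem_pow (hx.1 k) s
  exact (sup_le_sup_right (sup_le_sup_left h3 _) _ : _ ≤ _) h1

/-- The property (*) : sops are regular sequences modulo the zeroth local cohomology. -/
def Star (R : Type*) [CommRing R] [IsLocalRing R] (M : Type*) [AddCommGroup M] [Module R M]
    (d : ℕ) : Prop :=
  ∀ x : Fin d → R, IsSOP R M x → ∀ (T : Finset (Fin d)) (k : Fin d), k ∉ T → ∀ a : M,
    x k • a ∈ Ideal.span (x '' (T : Set (Fin d))) • (⊤ : Submodule R M) ⊔ H0m R M →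
    a ∈ Ideal.span (x '' (T : Set (Fin d))) • (⊤ : Submodule R M) ⊔ H0m R M

lemma s5e (h2 : 2 ≤ d) (hPD : ∀ x : Fin d → R, IsSOP R M x → HasParamDecomp R M x) :
    Star R M d := by
  intro x hx T k hk a ha
  obtain ⟨u, hu, w, hw, huw⟩ := Submodule.mem_sup.1 ha
  set y : Fin d → R := fun l => x l ^ (if l = k then 2 else 1) with hy
  have hyT : y '' (T : Set (Fin d)) = x '' (T : Set (Fin d)) := by
    apply Set.image_congr
    intro l hl
    have hl' : l ≠ k := by rintro rfl; exact hk hl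
    simp [hy, hl']
  have hyk : y k = x k ^ 2 := by simp [hy]
  have h1 := s5d hPD (x := y) (isSOP_pow hx _ (fun l => by split_ifs <;> omega)) hk (a := a) (by
    rw [hyT, hyk, pow_two, mul_smul, ← huw, smul_add, step3 h2 hPD hx k hw, add_zero]
    exact Submodule.smul_mem _ _ hu)
  rwa [hyT] at h1

end s3
end ParamDec

namespace ParamDec

section s4
variable {R : Type*} [CommRing R] [IsLocalRing R] [IsNoetherianRing R]
variable {M : Type*} [AddCommGroup M] [Module R M] [Module.Finite R M]
variable {d : ℕ}

lemma smul_W (hW : maximalIdeal R • H0m R M = ⊥) {r : R} (hr : r ∈ maximalIdeal R) {w : M}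
    (hw : w ∈ H0m R M) : r • w = 0 := by
  rw [← Submodule.mem_bot R, ← hW]
  exact Submodule.smul_mem_smul hr hw

lemma s8a (hS : Star R M d) (hW : maximalIdeal R • H0m R M = ⊥) {x : Fin d → R}
    (hx : IsSOP R M x) (T : Finset (Fin d)) (w : M) (hw : w ∈ H0m R M)
    (h : w ∈ Ideal.span (x '' (T : Set (Fin d))) • (⊤ : Submodule R M)) : w = 0 := by
  induction T using Finset.induction_on with
  | empty => simpa using h
  | insert k T hk ih =>
    rw [Finset.coe_insert, Set.image_insert_eq, Ideal.span_insert, Submodule.sup_smul] at h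
    obtain ⟨b', hb, u, hu, rfl⟩ := Submodule.mem_sup.1 h
    obtain ⟨b, _, rfl⟩ := (mem_span_smul _ _ _).1 hb
    apply ih
    refine Submodule.add_mem _ ?_ hu
    have h1 := hS x hx T k hk b (by
      have : x k • b = -u + (x k • b + u) := by abel
      rw [this]
      exact Submodule.add_mem_sup (Submodule.neg_mem _ hu) hw)
    obtain ⟨u', hu', w', hw', rfl⟩ := Submodule.mem_sup.1 h1
    rw [smul_add, smul_W hW (hx.1 k) hw', add_zero]
    exact Submodule.smul_mem _ _ hu'

lemma span_range_split (y : Fin d → R) (k : Fin d) :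
    Ideal.span (Set.range y) =
      Ideal.span {y k} ⊔ Ideal.span (y '' ((Finset.univ.erase k : Finset (Fin d)) : Set (Fin d))) := by
  rw [← Ideal.span_insert, ← Set.image_insert_eq, ← Finset.coe_insert,
    Finset.insert_erase (Finset.mem_univ k), Finset.coe_univ, Set.image_univ]

lemma s8b (hS : Star R M d) {x : Fin d → R} (hx : IsSOP R M x) (β : Fin d → ℕ)
    (T : Finset (Fin d)) (m : M)
    (h : (∏ i ∈ T, x i ^ β i) • m ∈
      Ideal.span (Set.range fun i => x i ^ (if i ∈ T then β i + 1 else 1)) • (⊤ : Submodule R M)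
        ⊔ H0m R M) :
    m ∈ Ideal.span (Set.range x) • (⊤ : Submodule R M) ⊔ H0m R M := by
  induction T using Finset.induction_on with
  | empty => simpa using h
  | insert k T hk ih =>
    apply ih
    set y : Fin d → R := fun i => x i ^ (if i ∈ T then β i + 1 else 1) with hy
    set z : Fin d → R := fun i => x i ^ (if i ∈ insert k T then β i + 1 else 1) with hz
    have hyk : y k = x k := by simp [hy, hk]
    have hzk : z k = x k ^ (β k + 1) := by simp [hz]
    have hzy : z '' ((Finset.univ.erase k : Finset (Fin d)) : Set (Fin d)) =
        y '' ((Finset.univ.erase k : Finset (Fin d)) : Set (Fin d)) := by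
      apply Set.image_congr
      intro l hl
      have : l ≠ k := by simpa using hl
      simp [hy, hz, this]
    rw [span_range_split z k, hzk, hzy, Submodule.sup_smul, sup_assoc, Finset.prod_insert hk,
      mul_smul] at h
    set n := (∏ i ∈ T, x i ^ β i) • m with hn
    obtain ⟨b', hb, u, hu, huw⟩ := Submodule.mem_sup.1 h
    obtain ⟨b, _, rfl⟩ := (mem_span_smul _ _ _).1 hb
    have h1 : x k ^ β k • (n - x k • b) ∈
        Ideal.span (y '' ((Finset.univ.erase k : Finset (Fin d)) : Set (Fin d))) •
          (⊤ : Submodule R M) ⊔ H0m R M := by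
      rw [smul_sub, ← huw, ← mul_smul, ← pow_succ, add_sub_cancel_left]
      exact hu
    have h2 : n - x k • b ∈
        Ideal.span (y '' ((Finset.univ.erase k : Finset (Fin d)) : Set (Fin d))) •
          (⊤ : Submodule R M) ⊔ H0m R M := by
      rcases Nat.eq_zero_or_pos (β k) with h0 | h0
      · rwa [h0, pow_zero, one_smul] at h1
      set v : Fin d → R := fun i => x i ^ (if i = k then β k else if i ∈ T then β i + 1 else 1) with hv
      have hvk : v k = x k ^ β k := by simp [hv]
      have hvy : v '' ((Finset.univ.erase k : Finset (Fin d)) : Set (Fin d)) =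
          y '' ((Finset.univ.erase k : Finset (Fin d)) : Set (Fin d)) := by
        apply Set.image_congr
        intro l hl
        have : l ≠ k := by simpa using hl
        simp [hy, hv, this]
      have := hS v (isSOP_pow hx _ (fun l => by split_ifs <;> omega)) (Finset.univ.erase k) k
        (by simp) (n - x k • b)
      rw [hvk, hvy] at this
      exact this h1
    rw [span_range_split y k, hyk, Submodule.sup_smul, sup_assoc]
    have : n = x k • b + (n - x k • b) := by abel
    rw [this]
    exact Submodule.add_mem_sup
      (Submodule.smul_mem_smul (Ideal.mem_span_singleton_self _) trivial) h2

lemma pow_le_iSup (x : Fin d → R) (n : ℕ) : Ideal.span (Set.range x) ^ n ≤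
    ⨆ β ∈ Finset.piAntidiag (Finset.univ : Finset (Fin d)) n,
      Ideal.span {∏ i, x i ^ β i} := by
  induction n with
  | zero =>
    refine le_iSup₂_of_le 0 (by simp) ?_
    simp
  | succ n ih =>
    rw [pow_succ]
    refine (Ideal.mul_mono ih le_rfl).trans ?_
    rw [Ideal.mul_le]
    intro r hr s hs
    induction hs using Submodule.span_induction with
    | zero => simp
    | add u v _ _ hu hv => rw [mul_add]; exact Ideal.add_mem _ hu hv
    | smul c u _ hu => rw [smul_eq_mul, mul_left_comm]; exact Ideal.mul_mem_left _ _ hu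
    | mem s hs =>
      obtain ⟨k, rfl⟩ := hs
      have : (⨆ β ∈ Finset.piAntidiag (Finset.univ : Finset (Fin d)) n,
        Ideal.span {∏ i, x i ^ β i}) ≤ Submodule.comap (LinearMap.mulRight R (x k))
          (⨆ β ∈ Finset.piAntidiag (Finset.univ : Finset (Fin d)) (n + 1),
            Ideal.span {∏ i, x i ^ β i}) := by
        refine iSup₂_le fun β hβ => ?_
        rw [Ideal.span_le, Set.singleton_subset_iff]
        rw [SetLike.mem_coe, Submodule.mem_comap, LinearMap.mulRight_apply]
        have hmem : β + Pi.single k 1 ∈ Finset.piAntidiag (Finset.univ : Finset (Fin d)) (n + 1) := by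
          rw [Finset.mem_piAntidiag] at hβ ⊢
          refine ⟨?_, by simp⟩
          simp [Finset.sum_add_distrib, hβ.1]
        refine (le_iSup₂_of_le (f := fun β (_ : β ∈ Finset.piAntidiag (Finset.univ : Finset (Fin d)) (n + 1)) =>
          Ideal.span {∏ i, x i ^ β i}) _ hmem le_rfl) ?_
        have e : ∏ i, x i ^ (β + Pi.single k 1 : Fin d → ℕ) i = (∏ i, x i ^ β i) * x k := by
          simp only [Pi.add_apply, pow_add, Finset.prod_mul_distrib]
          congr 1
          rw [Finset.prod_eq_single k]
          · simp
          · intro b _ hb; simp [hb]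
          · simp
        rw [e]
        exact Ideal.mem_span_singleton_self _
      exact this hr

lemma prod_mem_pow (x : Fin d → R) (β : Fin d → ℕ) (n : ℕ) (h : ∑ i, β i = n) :
    ∏ i, x i ^ β i ∈ Ideal.span (Set.range x) ^ n := by
  rw [← h, ← Finset.prod_pow_eq_pow_sum]
  exact Ideal.prod_mem_prod fun i _ => Ideal.pow_mem_pow (Ideal.subset_span (Set.mem_range_self i)) _

lemma s8c (hd : 1 ≤ d) (hS : Star R M d) {x : Fin d → R} (hx : IsSOP R M x) (n : ℕ) :
    (⨅ α ∈ Lambda d (n + 1), Ideal.span (Set.range fun i => x i ^ α i) • (⊤ : Submodule R M)) ≤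
      Ideal.span (Set.range x) ^ (n + 1) • (⊤ : Submodule R M) ⊔ H0m R M := by
  induction n with
  | zero =>
    refine (iInf₂_le (fun _ => 1) ⟨by simp, by simp⟩).trans ?_
    simp
  | succ n ih =>
    intro y hy
    simp only [Submodule.mem_iInf] at hy
    have hy1 := ih (x := y) (by
      simp only [Submodule.mem_iInf]
      intro α hα
      let k : Fin d := ⟨0, hd⟩
      refine Submodule.smul_mono ?_ le_rfl (hy (α + Pi.single k 1) ⟨fun i => ?_, ?_⟩)
      · rw [Ideal.span_le]
        rintro _ ⟨i, rfl⟩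
        simp only [Pi.add_apply, pow_add]
        exact Ideal.mul_mem_right _ _ (Ideal.subset_span ⟨i, rfl⟩)
      · have := hα.1 i
        simp only [Pi.add_apply]; omega
      · simp only [Pi.add_apply, Finset.sum_add_distrib, hα.2]
        simp
        omega)
    obtain ⟨z, hz, w, hw, rfl⟩ := Submodule.mem_sup.1 hy1
    have hz' := Submodule.smul_mono (pow_le_iSup x (n + 1)) le_rfl hz
    simp only [Submodule.iSup_smul] at hz'
    obtain ⟨f, hf⟩ := (Submodule.mem_iSup_finset_iff_exists_sum _ _).1 hz'
    have hg : ∀ β, ∃ m : M, (∏ i, x i ^ β i) • m = (f β : M) := fun β => by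
      obtain ⟨m, _, h⟩ := (mem_span_smul _ _ _).1 (f β).2
      exact ⟨m, h⟩
    choose g hg using hg
    refine Submodule.add_mem _ ?_ (Submodule.mem_sup_right hw)
    rw [← hf]
    refine Submodule.sum_mem _ fun β hβ => ?_
    have hβs : ∑ i, β i = n + 1 := (Finset.mem_piAntidiag.1 hβ).1
    have hyβ := hy (fun i => β i + 1) ⟨by simp, by
      simp only [Finset.sum_add_distrib, hβs]; simp; omega⟩
    have hm : g β ∈ Ideal.span (Set.range x) • (⊤ : Submodule R M) ⊔ H0m R M := by
      apply s8b hS hx β Finset.univ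
      simp only [Finset.mem_univ, if_true]
      rw [hg β]
      rw [← hf, ← Finset.add_sum_erase _ _ hβ] at hyβ
      set S := ∑ γ ∈ (Finset.piAntidiag Finset.univ (n + 1)).erase β, (f γ : M) with hSd
      have hSm : S ∈ Ideal.span (Set.range fun i => x i ^ (β i + 1)) • (⊤ : Submodule R M) := by
        refine Submodule.sum_mem _ fun γ hγ => ?_
        obtain ⟨hne, hγ⟩ := Finset.mem_erase.1 hγ
        have hγs : ∑ i, γ i = n + 1 := (Finset.mem_piAntidiag.1 hγ).1
        obtain ⟨i, hi⟩ : ∃ i, β i < γ i := by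
          by_contra! hcon
          apply hne
          have := (Finset.sum_eq_sum_iff_of_le (s := Finset.univ) (fun i _ => hcon i)).1
            (hγs.trans hβs.symm)
          funext i
          exact this i (Finset.mem_univ i)
        rw [← hg γ]
        refine Submodule.smul_mem_smul ?_ trivial
        rw [← Finset.mul_prod_erase _ _ (Finset.mem_univ i)]
        refine Ideal.mul_mem_right _ _ ?_
        obtain ⟨e, he⟩ := Nat.exists_eq_add_of_le (Nat.succ_le_of_lt hi)
        rw [he, pow_add]
        exact Ideal.mul_mem_right _ _ (Ideal.subset_span ⟨i, rfl⟩)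
      have : (f β : M) = ((f β + S + w) - S) + (-w) := by abel
      rw [this]
      exact Submodule.add_mem_sup (Submodule.sub_mem _ hyβ hSm) (Submodule.neg_mem _ hw)
    rw [← hg β]
    have h5 := Submodule.smul_mem_smul (prod_mem_pow x β _ hβs) hm
    rw [Submodule.smul_sup, ← mul_smul, ← pow_succ] at h5
    obtain ⟨u, hu, v, hv, huv⟩ := Submodule.mem_sup.1 h5
    rw [← huv]
    exact Submodule.add_mem_sup hu (Submodule.smul_le_right hv)

lemma s8 (hd : 1 ≤ d) (hS : Star R M d) (hW : maximalIdeal R • H0m R M = ⊥) (x : Fin d → R)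
    (hx : IsSOP R M x) : HasParamDecomp R M x := by
  intro n hn
  have hle : ∀ α ∈ Lambda d n, Ideal.span (Set.range x) ^ n • (⊤ : Submodule R M) ≤
      Ideal.span (Set.range fun i => x i ^ α i) • (⊤ : Submodule R M) := by
    intro α hα
    refine Submodule.smul_mono ?_ le_rfl
    have := span_pow_le x Finset.univ α n hα.1 (by rw [Lambda_sum hn hα]; omega)
    simpa using this
  refine le_antisymm (le_iInf₂ hle) ?_
  intro y hy
  obtain ⟨n, rfl⟩ : ∃ m, n = m + 1 := ⟨n - 1, by omega⟩
  obtain ⟨z, hz, w, hw, rfl⟩ := Submodule.mem_sup.1 (s8c hd hS hx n hy)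
  let k : Fin d := ⟨0, hd⟩
  have hα : (fun i => 1 + (Pi.single k n : Fin d → ℕ) i) ∈ Lambda d (n + 1) := by
    refine ⟨fun i => Nat.le_add_right _ _, ?_⟩
    simp [Finset.sum_add_distrib]
  simp only [Submodule.mem_iInf] at hy
  have h1 := Submodule.sub_mem _ (hy _ hα) (hle _ hα hz)
  rw [add_sub_cancel_left] at h1
  have h2 := s8a hS hW (isSOP_pow hx _ hα.1) Finset.univ w hw (by
    simpa using h1)
  rw [h2, add_zero]
  exact hz

end s4
end ParamDec

namespace ParamDec

open RingTheory.Sequence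
open scoped Pointwise

section s5
variable {R : Type*} [CommRing R] [IsLocalRing R] [IsNoetherianRing R]

lemma mk_mem_iff {M : Type*} [AddCommGroup M] [Module R M] (W : Submodule R M) (Q : Ideal R)
    (a : M) : W.mkQ a ∈ Q • (⊤ : Submodule R (M ⧸ W)) ↔ a ∈ Q • (⊤ : Submodule R M) ⊔ W := by
  rw [← Submodule.mem_comap, Submodule.comap_smul_top_of_surjective Q _ (Submodule.mkQ_surjective _),
    Submodule.ker_mkQ]

/-- dimension bound from parameters -/
lemma supportDim_le_length (xs : List R) : ∀ {K : Type*} [AddCommGroup K] [Module R K]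
    [Module.Finite R K], (∀ r ∈ xs, r ∈ maximalIdeal R) →
    (∀ P : Ideal R, P.IsPrime → Module.annihilator R K ≤ P → (∀ r ∈ xs, r ∈ P) →
      P = maximalIdeal R) → Module.supportDim R K ≤ xs.length := by
  induction xs with
  | nil =>
    intro K _ _ _ _ h
    have : Subsingleton (Module.support R K) := by
      constructor
      rintro ⟨p, hp⟩ ⟨q, hq⟩
      rw [Module.support_eq_zeroLocus] at hp hq
      apply Subtype.ext
      apply PrimeSpectrum.ext
      rw [h p.asIdeal p.2 hp (by simp), h q.asIdeal q.2 hq (by simp)]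
    unfold Module.supportDim
    simpa using Order.krullDim_nonpos_of_subsingleton
  | cons x xs ih =>
    intro K _ _ _ hm h
    have h1 := Module.supportDim_le_supportDim_quotSMulTop_succ (M := K) (hm x (by simp))
    have h2 := ih (K := QuotSMulTop x K) (fun r hr => hm r (by simp [hr])) (by
      intro P hP hle hr
      apply h P hP
      · refine le_trans ?_ hle
        exact LinearMap.annihilator_le_of_surjective (Submodule.mkQ _) (Submodule.mkQ_surjective _)
      · intro r hr'
        rcases List.mem_cons.1 hr' with rfl | h'
        · apply hle
          rw [Module.mem_annihilator]
          intro m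
          obtain ⟨m, rfl⟩ := Submodule.mkQ_surjective _ m
          rw [← map_smul]
          rw [Submodule.mkQ_apply, Submodule.Quotient.mk_eq_zero]
          exact Submodule.smul_mem_pointwise_smul _ _ _ trivial
        · exact hr r h')
    refine h1.trans ?_
    simp only [List.length_cons, Nat.cast_add, Nat.cast_one]
    gcongr

lemma supportDim_congr_ann {K L : Type*} [AddCommGroup K] [Module R K] [Module.Finite R K]
    [AddCommGroup L] [Module R L] [Module.Finite R L]
    (h : Module.annihilator R K = Module.annihilator R L) :
    Module.supportDim R K = Module.supportDim R L := by
  rw [Module.supportDim_eq_ringKrullDim_quotient_annihilator,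
    Module.supportDim_eq_ringKrullDim_quotient_annihilator, h]

/-- submodules of modules of large depth have large dimension -/
lemma length_le_supportDim (rs : List R) : ∀ {N : Type*} [AddCommGroup N] [Module R N]
    [Module.Finite R N], (∀ r ∈ rs, r ∈ maximalIdeal R) → IsWeaklyRegular N rs →
    ∀ K : Submodule R N, K ≠ ⊥ → (rs.length : WithBot ℕ∞) ≤ Module.supportDim R K := by
  induction rs with
  | nil =>
    intro N _ _ _ _ _ K hK
    have : Nontrivial K := (Submodule.nontrivial_iff_ne_bot).2 hK
    have : Nonempty (Module.support R K) := Set.Nonempty.to_subtype Module.nonempty_support_of_nontrivial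
    unfold Module.supportDim
    simpa using Order.krullDim_nonneg
  | cons y rs ih =>
    intro N _ _ _ hm hreg K hK
    rw [isWeaklyRegular_cons_iff] at hreg
    set K' : Submodule R N := Submodule.torsionBySet R N (Module.annihilator R K : Set R) with hK'
    have hmem : ∀ m : N, m ∈ K' ↔ ∀ r ∈ Module.annihilator R K, r • m = 0 := by
      intro m
      simp [hK', Submodule.mem_torsionBySet_iff]
    have hle : K ≤ K' := by
      intro m hmK
      rw [hmem]
      intro r hr
      have := Module.mem_annihilator.1 hr ⟨m, hmK⟩
      simpa using congrArg Subtype.val this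
    have hann : Module.annihilator R K = Module.annihilator R K' := by
      apply le_antisymm
      · intro r hr
        rw [Module.mem_annihilator]
        rintro ⟨m, hm⟩
        apply Subtype.ext
        simpa using (hmem m).1 hm r hr
      · exact LinearMap.annihilator_le_of_injective (Submodule.inclusion hle)
          (Submodule.inclusion_injective hle)
    rw [supportDim_congr_ann hann]
    set f := (Submodule.mkQ (y • (⊤ : Submodule R N)))
    have hne : K'.map f ≠ ⊥ := by
      intro h
      apply hK
      rw [eq_bot_iff]
      refine hle.trans ?_
      rw [← eq_bot_iff]
      apply Submodule.eq_bot_of_le_smul_of_le_jacobson_bot (Ideal.span {y}) _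
        (IsNoetherian.noetherian _)
      · intro m hmK
        have h1 : f m ∈ K'.map f := Submodule.mem_map_of_mem hmK
        rw [h, Submodule.mem_bot, Submodule.mkQ_apply, Submodule.Quotient.mk_eq_zero,
          Submodule.mem_smul_pointwise_iff_exists] at h1
        obtain ⟨m', _, rfl⟩ := h1
        refine Submodule.smul_mem_smul (Ideal.mem_span_singleton_self _) ?_
        rw [hmem] at hmK ⊢
        intro r hr
        apply hreg.1
        simp only [smul_zero]
        rw [smul_comm, hmK r hr]
      · refine le_trans ?_ (maximalIdeal_le_jacobson _)
        rw [Ideal.span_le]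
        simpa using hm y (by simp)
    have h1 := ih (N := QuotSMulTop y N) (fun r hr => hm r (by simp [hr])) hreg.2 (K'.map f) hne
    have hregK : IsSMulRegular K' y := by
      intro u v huv
      apply Subtype.ext
      apply hreg.1
      simpa using congrArg Subtype.val huv
    have h2 := Module.supportDim_quotSMulTop_succ_eq_supportDim hregK (hm y (by simp))
    let g : K' →ₗ[R] K'.map f := f.submoduleMap K'
    have hg : Function.Surjective g := LinearMap.submoduleMap_surjective _ _
    let g' : QuotSMulTop y K' →ₗ[R] K'.map f := Submodule.liftQ _ g (by
      intro u hu
      obtain ⟨v, _, rfl⟩ := (Submodule.mem_smul_pointwise_iff_exists _ _ _).1 hu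
      rw [LinearMap.mem_ker]
      apply Subtype.ext
      change f (y • (v : N)) = 0
      rw [Submodule.mkQ_apply, Submodule.Quotient.mk_eq_zero]
      exact Submodule.smul_mem_pointwise_smul _ _ _ trivial)
    have hg' : Function.Surjective g' := by
      intro v
      obtain ⟨u, rfl⟩ := hg v
      exact ⟨Submodule.mkQ _ u, by simp [g']⟩
    have h3 := Module.supportDim_le_of_surjective g' hg'
    rw [← h2]
    simp only [List.length_cons, Nat.cast_add, Nat.cast_one]
    gcongr
    exact h1.trans h3

end s5

section s6
universe u v
variable {R : Type u} [CommRing R] [IsLocalRing R] [IsNoetherianRing R]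

open CategoryTheory Abelian in
lemma depth_drop [Small.{v} R] {N : Type v} [AddCommGroup N] [Module R N] [Module.Finite R N]
    [Nontrivial N] {n : ℕ} (h : ∃ rs : List R, rs.length = n + 1 ∧ (∀ r ∈ rs, r ∈ maximalIdeal R) ∧
      IsRegular N rs) {x : R} (hxm : x ∈ maximalIdeal R) (hx : IsSMulRegular N x) :
    ∃ rs : List R, rs.length = n ∧ (∀ r ∈ rs, r ∈ maximalIdeal R) ∧
      IsRegular (QuotSMulTop x N) rs := by
  have hlt : ∀ (L : Type v) [AddCommGroup L] [Module R L] [Module.Finite R L] [Nontrivial L],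
      maximalIdeal R • (⊤ : Submodule R L) < ⊤ := by
    intro L _ _ _ _
    refine lt_top_iff_ne_top.2 fun he => ?_
    have := Submodule.eq_bot_of_le_smul_of_le_jacobson_bot (maximalIdeal R) (⊤ : Submodule R L)
      (IsNoetherian.noetherian _) he.ge (maximalIdeal_le_jacobson _)
    exact top_ne_bot this
  have : Nontrivial (QuotSMulTop x N) := nontrivial_quotSMulTop_of_mem_maximalIdeal _ hxm
  have h1 := ((ModuleCat.exists_isRegular_tfae (maximalIdeal R) (n + 1) (ModuleCat.of R N)
    (hlt N)).out 3 1).1 h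
  refine ((ModuleCat.exists_isRegular_tfae (maximalIdeal R) n (ModuleCat.of R (QuotSMulTop x N))
    (hlt _)).out 1 3).1 ?_
  intro i hi
  have zero1 := AddCommGrpCat.isZero_of_iff_subsingleton.mpr (h1 i (by omega))
  have zero2 := AddCommGrpCat.isZero_of_iff_subsingleton.mpr (h1 (i + 1) (by omega))
  have hx' : IsSMulRegular (ModuleCat.of R N) x := hx
  exact AddCommGrpCat.subsingleton_of_isZero <| ShortComplex.Exact.isZero_of_both_zeros
    ((Ext.covariant_sequence_exact₃' _ hx'.smulShortComplex_shortExact) i (i + 1) rfl)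
    (zero1.eq_zero_of_src _) (zero2.eq_zero_of_tgt _)

lemma sop_regular [Small.{v} R] (xs : List R) : ∀ {N : Type v} [AddCommGroup N] [Module R N]
    [Module.Finite R N] [Nontrivial N],
    (∃ rs : List R, rs.length = xs.length ∧ (∀ r ∈ rs, r ∈ maximalIdeal R) ∧ IsRegular N rs) →
    (∀ r ∈ xs, r ∈ maximalIdeal R) →
    (∀ P : Ideal R, P.IsPrime → Module.annihilator R N ≤ P → (∀ r ∈ xs, r ∈ P) →
      P = maximalIdeal R) → IsWeaklyRegular N xs := by
  induction xs with
  | nil => intros; exact IsWeaklyRegular.nil _ _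
  | cons x xs ih =>
    intro N _ _ _ _ hrs hm h
    have hxm : x ∈ maximalIdeal R := hm x (by simp)
    have hx : IsSMulRegular N x := by
      obtain ⟨rs, hlen, hrm, hreg⟩ := hrs
      rw [isSMulRegular_iff_right_eq_zero_of_smul]
      intro a ha
      by_contra hne
      have h1 := length_le_supportDim rs hrm hreg.toIsWeaklyRegular (Submodule.span R {a})
        (by simpa using hne)
      have h2 := supportDim_le_length (R := R) xs (K := Submodule.span R {a})
        (fun r hr => hm r (by simp [hr])) (by
          intro P hP hle hr
          apply h P hP
          · refine le_trans ?_ hle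
            exact LinearMap.annihilator_le_of_injective (Submodule.subtype _)
              (Submodule.subtype_injective _)
          · intro r hr'
            rcases List.mem_cons.1 hr' with rfl | h'
            · apply hle
              rw [Module.mem_annihilator]
              rintro ⟨m, hm⟩
              obtain ⟨c, rfl⟩ := Submodule.mem_span_singleton.1 hm
              apply Subtype.ext
              change r • c • a = 0
              rw [smul_comm, ha, smul_zero]
            · exact hr r h')
      have h3 := h1.trans h2
      rw [hlen] at h3
      have h4 : (x :: xs).length ≤ xs.length := by exact_mod_cast h3
      simp at h4
    rw [isWeaklyRegular_cons_iff]
    have : Nontrivial (QuotSMulTop x N) := nontrivial_quotSMulTop_of_mem_maximalIdeal _ hxm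
    refine ⟨hx, ih (depth_drop hrs hxm hx) (fun r hr => hm r (by simp [hr])) ?_⟩
    intro P hP hle hr
    apply h P hP
    · refine le_trans ?_ hle
      exact LinearMap.annihilator_le_of_surjective (Submodule.mkQ _) (Submodule.mkQ_surjective _)
    · intro r hr'
      rcases List.mem_cons.1 hr' with rfl | h'
      · apply hle
        rw [Module.mem_annihilator]
        intro m
        obtain ⟨m, rfl⟩ := Submodule.mkQ_surjective _ m
        rw [← map_smul]
        rw [Submodule.mkQ_apply, Submodule.Quotient.mk_eq_zero]
        exact Submodule.smul_mem_pointwise_smul _ _ _ trivial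
      · exact hr r h'

lemma sop_regular' (xs : List R) {N : Type v} [AddCommGroup N] [Module R N]
    [Module.Finite R N] [Nontrivial N]
    (hrs : ∃ rs : List R, rs.length = xs.length ∧ (∀ r ∈ rs, r ∈ maximalIdeal R) ∧ IsRegular N rs)
    (hm : ∀ r ∈ xs, r ∈ maximalIdeal R)
    (h : ∀ P : Ideal R, P.IsPrime → Module.annihilator R N ≤ P → (∀ r ∈ xs, r ∈ P) →
      P = maximalIdeal R) : IsWeaklyRegular N xs := by
  let e : ULift.{u} N ≃ₗ[R] N := ULift.moduleEquiv
  rw [← e.isWeaklyRegular_congr]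
  have : Small.{max u v} R := inferInstance
  have : Module.Finite R (ULift.{u} N) := Module.Finite.equiv e.symm
  apply sop_regular.{u, max u v} xs
  · obtain ⟨rs, h1, h2, h3⟩ := hrs
    exact ⟨rs, h1, h2, (e.isRegular_congr rs).2 h3⟩
  · exact hm
  · intro P hP hle
    rw [e.annihilator_eq] at hle
    exact h P hP hle

end s6
end ParamDec

namespace ParamDec

open RingTheory.Sequence
open scoped Pointwise

section s7
variable {R : Type*} [CommRing R] [IsLocalRing R] [IsNoetherianRing R]
variable {M : Type*} [AddCommGroup M] [Module R M] [Module.Finite R M]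
variable {d : ℕ}

lemma ann_le_iff_of_ne (P : Ideal R) (hP : P.IsPrime) (hne : P ≠ maximalIdeal R) :
    Module.annihilator R (M ⧸ H0m R M) ≤ P ↔ Module.annihilator R M ≤ P := by
  constructor
  · intro h
    exact (LinearMap.annihilator_le_of_surjective (Submodule.mkQ _)
      (Submodule.mkQ_surjective _)).trans h
  · intro h
    obtain ⟨n, hn⟩ := H0m_pow (R := R) (M := M)
    have h1 : maximalIdeal R ^ n * Module.annihilator R (M ⧸ H0m R M) ≤ P := by
      refine le_trans ?_ h
      rw [Ideal.mul_le]
      intro r hr s hs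
      rw [Module.mem_annihilator]
      intro m
      rw [mul_smul]
      apply hn _ _ _ hr
      have := Module.mem_annihilator.1 hs (Submodule.mkQ _ m)
      rwa [← map_smul, Submodule.mkQ_apply, Submodule.Quotient.mk_eq_zero] at this
    rcases (hP.mul_le).1 h1 with h2 | h2
    · exact absurd (le_antisymm (le_maximalIdeal hP.ne_top) (Ideal.IsPrime.le_of_pow_le h2)) hne
    · exact h2

lemma nontrivial_N (hd : moduleDim R M = (d : WithBot ℕ∞)) (h2 : 2 ≤ d) :
    Nontrivial (M ⧸ H0m R M) := by
  by_contra hcon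
  have hsub : Subsingleton (M ⧸ H0m R M) := not_nontrivial_iff_subsingleton.1 hcon
  have htop : Module.annihilator R (M ⧸ H0m R M) = ⊤ := Module.annihilator_eq_top_iff.2 hsub
  have h1 : Module.supportDim R M ≤ (([] : List R).length : WithBot ℕ∞) := by
    apply supportDim_le_length
    · simp
    · intro P hP hle _
      by_contra hne
      rw [← ann_le_iff_of_ne P hP hne, htop, top_le_iff] at hle
      exact hP.ne_top hle
  rw [Module.supportDim_eq_ringKrullDim_quotient_annihilator] at h1
  have h3 : (d : WithBot ℕ∞) ≤ ((0 : ℕ) : WithBot ℕ∞) := by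
    rw [← hd]; exact h1
  have : d ≤ 0 := by exact_mod_cast h3
  omega

lemma ann_le_iff (hd : moduleDim R M = (d : WithBot ℕ∞)) (h2 : 2 ≤ d) (P : Ideal R)
    (hP : P.IsPrime) :
    Module.annihilator R (M ⧸ H0m R M) ≤ P ↔ Module.annihilator R M ≤ P := by
  by_cases hne : P = maximalIdeal R
  · have := nontrivial_N hd h2
    have h1 : Module.annihilator R (M ⧸ H0m R M) ≤ P := by
      rw [hne]
      apply le_maximalIdeal
      rw [Ne, Module.annihilator_eq_top_iff]
      exact not_subsingleton _
    exact ⟨fun h => (LinearMap.annihilator_le_of_surjective (Submodule.mkQ _)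
      (Submodule.mkQ_surjective _)).trans h, fun _ => h1⟩
  · exact ann_le_iff_of_ne P hP hne

lemma dim_N (hd : moduleDim R M = (d : WithBot ℕ∞)) (h2 : 2 ≤ d) :
    moduleDim R (M ⧸ H0m R M) = (d : WithBot ℕ∞) := by
  rw [← hd]
  unfold moduleDim
  rw [ringKrullDim_quotient, ringKrullDim_quotient]
  have : PrimeSpectrum.zeroLocus (Module.annihilator R (M ⧸ H0m R M) : Set R) =
      PrimeSpectrum.zeroLocus (Module.annihilator R M : Set R) := by
    ext P
    exact ann_le_iff hd h2 P.asIdeal P.2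
  rw [this]

lemma star_of_CM (hd : moduleDim R M = (d : WithBot ℕ∞)) (h2 : 2 ≤ d)
    (hCM : IsCM R (M ⧸ H0m R M)) : Star R M d := by
  have hN := nontrivial_N hd h2
  have hdep : moduleDepth R (M ⧸ H0m R M) = (d : ℕ∞) := by
    unfold IsCM at hCM
    rw [dim_N hd h2] at hCM
    exact_mod_cast hCM
  have hrs : ∃ rs : List R, rs.length = d ∧ (∀ r ∈ rs, r ∈ maximalIdeal R) ∧
      IsRegular (M ⧸ H0m R M) rs := by
    obtain ⟨rs, hlen, hm, hreg⟩ : ∃ rs : List R, d ≤ rs.length ∧ (∀ r ∈ rs, r ∈ maximalIdeal R) ∧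
        IsRegular (M ⧸ H0m R M) rs := by
      by_contra! hcon
      have : moduleDepth R (M ⧸ H0m R M) ≤ ((d - 1 : ℕ) : ℕ∞) := by
        apply sSup_le
        rintro _ ⟨rs, rfl, hm, hreg⟩
        by_contra hlt
        refine hcon rs ?_ hm hreg
        by_contra hlt2
        apply hlt
        have : rs.length ≤ d - 1 := by omega
        exact_mod_cast this
      rw [hdep] at this
      have : d ≤ d - 1 := by exact_mod_cast this
      omega
    have hm' : ∀ r ∈ rs.take d, r ∈ maximalIdeal R := fun r hr => hm r (List.mem_of_mem_take hr)
    refine ⟨rs.take d, by simpa using hlen, hm', ?_⟩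
    rw [IsLocalRing.isRegular_iff_isWeaklyRegular_of_subset_maximalIdeal hm']
    have h3 := hreg.toIsWeaklyRegular
    rw [← List.take_append_drop d rs, isWeaklyRegular_append_iff] at h3
    exact h3.1
  intro x hx T k hk a ha
  rw [isSOP_iff] at hx
  have hmemall : ∀ i : Fin d,
      x i ∈ T.toList.map x ++ x k :: ((Finset.univ.erase k \ T).toList.map x) := by
    intro i
    simp only [List.mem_append, List.mem_cons, List.mem_map, Finset.mem_toList, Finset.mem_sdiff,
      Finset.mem_erase, Finset.mem_univ, and_true]
    by_cases h1 : i ∈ T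
    · exact Or.inl ⟨i, h1, rfl⟩
    by_cases h3 : i = k
    · subst h3; exact Or.inr (Or.inl rfl)
    · exact Or.inr (Or.inr ⟨i, ⟨h3, h1⟩, rfl⟩)
  have hlen : (T.toList.map x ++ x k :: ((Finset.univ.erase k \ T).toList.map x)).length = d := by
    simp only [List.length_append, List.length_cons, List.length_map, Finset.length_toList]
    have hsub : T ⊆ Finset.univ.erase k := fun i hi =>
      Finset.mem_erase.2 ⟨by rintro rfl; exact hk hi, Finset.mem_univ _⟩
    rw [Finset.card_sdiff_of_subset hsub, Finset.card_erase_of_mem (Finset.mem_univ _),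
      Finset.card_univ, Fintype.card_fin]
    have := Finset.card_le_card hsub
    rw [Finset.card_erase_of_mem (Finset.mem_univ _), Finset.card_univ, Fintype.card_fin] at this
    omega
  have hw := sop_regular' (R := R) (N := M ⧸ H0m R M)
    (T.toList.map x ++ x k :: ((Finset.univ.erase k \ T).toList.map x)) (by rw [hlen]; exact hrs)
    (by
      intro r hr
      simp only [List.mem_append, List.mem_cons, List.mem_map] at hr
      rcases hr with ⟨i, _, rfl⟩ | rfl | ⟨i, _, rfl⟩ <;> exact hx.1 _)
    (by
      intro P hP hle hr
      exact hx.2 P hP ((ann_le_iff hd h2 P hP).1 hle) fun i => hr _ (hmemall i))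
  rw [isWeaklyRegular_append_iff, isWeaklyRegular_cons_iff] at hw
  have hreg := hw.2.1
  rw [isSMulRegular_quotient_iff_mem_of_smul_mem] at hreg
  have hof : Ideal.ofList (T.toList.map x) = Ideal.span (x '' (T : Set (Fin d))) := by
    unfold Ideal.ofList
    congr 1
    ext r
    simp
  rw [hof] at hreg
  rw [← mk_mem_iff] at ha ⊢
  rw [map_smul] at ha
  exact hreg _ ha

lemma CM_of_star (hd : moduleDim R M = (d : WithBot ℕ∞)) (h2 : 2 ≤ d)
    (hS : Star R M d) : IsCM R (M ⧸ H0m R M) := by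
  have hN := nontrivial_N hd h2
  obtain ⟨x, hx⟩ := exists_sop hd
  have hdim := dim_N hd h2
  unfold IsCM
  rw [hdim]
  have : moduleDepth R (M ⧸ H0m R M) = (d : ℕ∞) := by
    apply le_antisymm
    · apply sSup_le
      rintro _ ⟨rs, rfl, hm, hreg⟩
      have h1 := Module.supportDim_add_length_eq_supportDim_of_isRegular rs hreg
      rw [Module.supportDim_eq_ringKrullDim_quotient_annihilator R (M ⧸ H0m R M),
        show ringKrullDim (R ⧸ Module.annihilator R (M ⧸ H0m R M)) = d from hdim] at h1
      have hnt : Nontrivial ((M ⧸ H0m R M) ⧸ Ideal.ofList rs • (⊤ : Submodule R (M ⧸ H0m R M))) :=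
        Submodule.Quotient.nontrivial_iff.2 hreg.top_ne_smul.symm
      have : Nonempty (Module.support R ((M ⧸ H0m R M) ⧸ Ideal.ofList rs •
          (⊤ : Submodule R (M ⧸ H0m R M)))) :=
        Set.Nonempty.to_subtype Module.nonempty_support_of_nontrivial
      have h0 : 0 ≤ Module.supportDim R ((M ⧸ H0m R M) ⧸ Ideal.ofList rs •
          (⊤ : Submodule R (M ⧸ H0m R M))) := Order.krullDim_nonneg
      have h3 : (rs.length : WithBot ℕ∞) ≤ (d : WithBot ℕ∞) := by
        rw [← h1]
        exact le_add_of_nonneg_left h0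
      exact_mod_cast h3
    · apply le_sSup
      have hm : ∀ r ∈ List.ofFn x, r ∈ maximalIdeal R := by
        intro r hr
        obtain ⟨i, rfl⟩ := (List.mem_ofFn' _ _).1 hr
        exact hx.1 i
      refine ⟨List.ofFn x, by simp, hm, ?_⟩
      rw [IsLocalRing.isRegular_iff_isWeaklyRegular_of_subset_maximalIdeal hm, isWeaklyRegular_iff]
      intro i hi
      have hi' : i < d := by simpa using hi
      rw [isSMulRegular_quotient_iff_mem_of_smul_mem]
      let T : Finset (Fin d) := Finset.univ.filter fun j => (j : ℕ) < i
      have hof : Ideal.ofList ((List.ofFn x).take i) = Ideal.span (x '' (T : Set (Fin d))) := by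
        unfold Ideal.ofList
        congr 1
        ext r
        simp only [Set.mem_setOf_eq, List.mem_take_iff_getElem, List.getElem_ofFn, List.length_ofFn]
        constructor
        · rintro ⟨j, hj, rfl⟩
          exact ⟨⟨j, by omega⟩, by simp [T]; omega, rfl⟩
        · rintro ⟨j, hj, rfl⟩
          have : (j : ℕ) < i := by simpa [T] using hj
          exact ⟨j, by omega, rfl⟩
      rw [hof]
      intro a ha
      obtain ⟨a, rfl⟩ := Submodule.mkQ_surjective _ a
      rw [← map_smul, mk_mem_iff] at ha
      rw [mk_mem_iff]
      rw [List.getElem_ofFn] at ha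
      exact hS x hx T ⟨i, hi'⟩ (by simp [T]) a ha
  rw [this]
  rfl

end s7
end ParamDec

/-- **Corollary 1.2 (Goto-Shimoda, module version).** For `dim M ≥ 2`:
`M/H⁰_𝔪(M)` is Cohen-Macaulay and `𝔪·H⁰_𝔪(M) = 0` iff every system of parameters
of `M` has the property of parametric decomposition. -/
theorem stmt_3 {R : Type*} [CommRing R] [IsLocalRing R] [IsNoetherianRing R]
    {M : Type*} [AddCommGroup M] [Module R M] [Module.Finite R M]
    {d : ℕ} (hd : moduleDim R M = (d : WithBot ℕ∞)) (h2 : 2 ≤ d) :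
    (IsCM R (M ⧸ H0m R M) ∧ maximalIdeal R • H0m R M = ⊥) ↔
      ∀ x : Fin d → R, IsSOP R M x → HasParamDecomp R M x := by
  constructor
  · rintro ⟨hCM, hW⟩
    exact ParamDec.s8 (by omega) (ParamDec.star_of_CM hd h2 hCM) hW
  · intro hPD
    exact ⟨ParamDec.CM_of_star hd h2 (ParamDec.s5e h2 hPD), ParamDec.step4 hd h2 hPD⟩
end

section
/- Let (R, 𝔪) be a commutative Noetherian local ring, M a finitely generated R-module of dimension d with dimension filtration D_0 ⊂ D_1 ⊂ ⋯ ⊂ D_t = M, and let x_1, …, x_d be a good system of parameters of M. Then D_i = (0 :_M x_j) for all j with d_i + 1 ≤ j ≤ d_{i+1} and all i = 0, 1, …, t−1; in particular (0 :_M x_1) ⊆ (0 :_M x_2) ⊆ ⋯ ⊆ (0 :_M x_d). -/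
open IsLocalRing

/-- A finite length module over a local ring is killed by a power of the maximal ideal. -/
lemma aux_pow_le_annihilator {R : Type*} [CommRing R] [IsLocalRing R] {Q : Type*}
    [AddCommGroup Q] [Module R Q] (h : IsFiniteLength R Q) :
    ∃ n : ℕ, maximalIdeal R ^ n ≤ Module.annihilator R Q := by
  induction h with
  | @of_subsingleton M _ _ _ =>
    refine ⟨0, fun r _ => ?_⟩
    rw [Module.mem_annihilator]
    intro m
    exact Subsingleton.elim _ _
  | @of_simple_quotient M _ _ N _ hN ih =>
    obtain ⟨n, hn⟩ := ih
    refine ⟨n + 1, ?_⟩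
    rw [pow_succ, Ideal.mul_le]
    intro r hr s hs
    rw [Module.mem_annihilator]
    intro m
    have hmax := IsLocalRing.eq_maximalIdeal
      (IsSimpleModule.annihilator_isMaximal (R := R) (M := M ⧸ N))
    have h1 : s • m ∈ N := by
      rw [← hmax, Module.mem_annihilator] at hs
      have := hs (Submodule.Quotient.mk m)
      rwa [← Submodule.Quotient.mk_smul, Submodule.Quotient.mk_eq_zero] at this
    have h2 := Module.mem_annihilator.mp (hn hr) ⟨s • m, h1⟩
    rw [mul_smul]
    exact congrArg Subtype.val h2

/-- If every prime containing `J` and the finite set `s` is maximal, then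
`dim R/J ≤ card s`. -/
lemma aux_dim_le {R : Type*} [CommRing R] [IsLocalRing R] [IsNoetherianRing R]
    (J : Ideal R) (s : Finset R)
    (h : ∀ p : Ideal R, p.IsPrime → J ≤ p → (∀ a ∈ s, a ∈ p) → maximalIdeal R ≤ p)
    (hs : ∀ a ∈ s, a ∈ maximalIdeal R) :
    ringKrullDim (R ⧸ J) ≤ ((s.card : ℕ) : WithBot ℕ∞) := by
  classical
  rcases subsingleton_or_nontrivial (R ⧸ J) with hsub | hnt
  · rw [ringKrullDim_eq_bot_of_subsingleton]
    exact bot_le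
  have hsurj : Function.Surjective (Ideal.Quotient.mk J) := Ideal.Quotient.mk_surjective
  have : IsLocalRing (R ⧸ J) := IsLocalRing.of_surjective' _ hsurj
  have hloc : IsLocalHom (Ideal.Quotient.mk J) := IsLocalHom.of_surjective _ hsurj
  have hmin : maximalIdeal (R ⧸ J) ∈
      (Ideal.span ((s.image (Ideal.Quotient.mk J) : Finset (R ⧸ J)) : Set (R ⧸ J))).minimalPrimes := by
    refine ⟨⟨inferInstance, ?_⟩, ?_⟩
    · rw [Ideal.span_le]
      intro b hb
      obtain ⟨a, ha, rfl⟩ := Finset.mem_image.mp (Finset.mem_coe.mp hb)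
      have := hs a ha
      rw [← IsLocalRing.maximalIdeal_comap (Ideal.Quotient.mk J)] at this
      exact this
    · rintro q ⟨hq, hsq⟩ -
      have h1 := h (q.comap (Ideal.Quotient.mk J)) (Ideal.comap_isPrime _ _)
        (fun a ha => by
          rw [Ideal.mem_comap, Ideal.Quotient.eq_zero_iff_mem.mpr ha]
          exact q.zero_mem)
        (fun a ha => hsq (Ideal.subset_span
          (Finset.mem_coe.mpr (Finset.mem_image_of_mem _ ha))))
      rw [← IsLocalRing.map_maximalIdeal_of_surjective (Ideal.Quotient.mk J) hsurj]
      exact Ideal.map_le_iff_le_comap.mpr h1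
  have hle := Ideal.height_le_card_of_mem_minimalPrimes_span_finset hmin
  rw [← IsLocalRing.maximalIdeal_height_eq_ringKrullDim]
  have : ((maximalIdeal (R ⧸ J)).height : ℕ∞) ≤ ((s.card : ℕ) : ℕ∞) :=
    hle.trans (by exact_mod_cast Finset.card_image_le)
  exact_mod_cast this

lemma aux_H0m_dim {R : Type*} [CommRing R] [IsLocalRing R] [IsNoetherianRing R]
    {M : Type*} [AddCommGroup M] [Module R M] [Module.Finite R M] :
    moduleDim R ↥(H0m R M) ≤ 0 := by
  have := aux_dim_le (Module.annihilator R ↥(H0m R M)) ∅ ?_ (by simp)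
  · simpa [moduleDim] using this
  intro p hp hJ _
  have hsup : (⟨p, hp⟩ : PrimeSpectrum R) ∈ Module.support R ↥(H0m R M) := by
    rw [Module.support_eq_zeroLocus]
    exact hJ
  obtain ⟨⟨m, hm⟩, hmp⟩ := Module.mem_support_iff_exists_annihilator.mp hsup
  have hdir : Directed (· ≤ ·) fun n : ℕ =>
      Submodule.torsionBySet R M ((maximalIdeal R ^ n : Ideal R) : Set R) := by
    apply Monotone.directed_le
    intro a b hab
    exact Submodule.torsionBySet_le_torsionBySet_of_subset (Ideal.pow_le_pow_right hab)
  obtain ⟨n, hn⟩ := (Submodule.mem_iSup_of_directed _ hdir).mp hm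
  rw [Submodule.mem_torsionBySet_iff] at hn
  have hle : maximalIdeal R ^ n ≤ p := by
    intro r hr
    apply hmp
    rw [Submodule.mem_annihilator_span_singleton]
    exact Subtype.ext (hn ⟨r, hr⟩)
  exact hp.le_of_pow_le hle

lemma aux_key {R : Type*} [CommRing R] [IsLocalRing R] [IsNoetherianRing R]
    {M : Type*} [AddCommGroup M] [Module R M] [Module.Finite R M]
    {d : ℕ} (x : Fin d → R) (hx : IsSOP R M x) (N : Submodule R M) (c : ℕ) (j : Fin d)
    (hj : (j : ℕ) < c) (hjN : N ≤ Submodule.torsionBy R M (x j))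
    (hk : ∀ k : Fin d, c ≤ (k : ℕ) → N ≤ Submodule.torsionBy R M (x k)) :
    moduleDim R ↥N < (c : WithBot ℕ∞) := by
  classical
  have hann : ∀ k : Fin d, N ≤ Submodule.torsionBy R M (x k) →
      x k ∈ Module.annihilator R ↥N := by
    intro k hkN
    rw [Module.mem_annihilator]
    intro m
    exact Subtype.ext ((Submodule.mem_torsionBy_iff _ _).mp (hkN m.2))
  set T : Finset (Fin d) := Finset.univ.filter fun k => (k : ℕ) < c ∧ k ≠ j with hT
  have hcard : T.card < c := by
    have h1 : (T.image (fun k : Fin d => (k : ℕ))) ⊆ (Finset.range c).erase (j : ℕ) := by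
      intro a ha
      obtain ⟨k, hk', rfl⟩ := Finset.mem_image.mp ha
      simp only [hT, Finset.mem_filter, Finset.mem_univ, true_and] at hk'
      simp only [Finset.mem_erase, Finset.mem_range]
      exact ⟨fun h => hk'.2 (Fin.ext h), hk'.1⟩
    have h2 := Finset.card_le_card h1
    rw [Finset.card_image_of_injective _ Fin.val_injective,
      Finset.card_erase_of_mem (Finset.mem_range.mpr hj), Finset.card_range] at h2
    omega
  have hdim := aux_dim_le (Module.annihilator R ↥N) (T.image x) ?_ ?_
  · refine lt_of_le_of_lt hdim ?_
    have : (T.image x).card < c := lt_of_le_of_lt Finset.card_image_le hcard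
    exact_mod_cast this
  · intro p hp hJ hTp
    have hxp : ∀ k, x k ∈ p := by
      intro k
      by_cases h1 : c ≤ (k : ℕ)
      · exact hJ (hann k (hk k h1))
      by_cases h2 : k = j
      · subst h2; exact hJ (hann k hjN)
      · exact hTp _ (Finset.mem_image_of_mem _ (by simp [hT, h2]; omega))
    have hMp : Module.annihilator R M ≤ p := by
      refine le_trans ?_ hJ
      exact LinearMap.annihilator_le_of_injective N.subtype N.injective_subtype
    have hsup : (⟨p, hp⟩ : PrimeSpectrum R) ∈
        Module.support R (M ⧸ (Ideal.span (Set.range x) • (⊤ : Submodule R M))) := by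
      rw [Module.support_quotient]
      refine ⟨?_, ?_⟩
      · rw [Module.support_eq_zeroLocus]
        exact hMp
      · rw [PrimeSpectrum.mem_zeroLocus]
        refine Ideal.span_le.mpr ?_
        rintro _ ⟨k, rfl⟩
        exact hxp k
    rw [Module.support_eq_zeroLocus] at hsup
    obtain ⟨n, hn⟩ := aux_pow_le_annihilator hx.2
    exact hp.le_of_pow_le (hn.trans hsup)
  · intro a ha
    obtain ⟨k, _, rfl⟩ := Finset.mem_image.mp ha
    exact hx.1 k

lemma aux_moduleDim_bot {R : Type*} [CommRing R] {M : Type*} [AddCommGroup M] [Module R M] :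
    moduleDim R ↥(⊥ : Submodule R M) = ⊥ := by
  have : Module.annihilator R ↥(⊥ : Submodule R M) = ⊤ :=
    Module.annihilator_eq_top_iff.mpr inferInstance
  have : Subsingleton (R ⧸ Module.annihilator R ↥(⊥ : Submodule R M)) :=
    Ideal.Quotient.subsingleton_iff.mpr this
  exact ringKrullDim_eq_bot_of_subsingleton

lemma aux_moduleDim_top {R : Type*} [CommRing R] {M : Type*} [AddCommGroup M] [Module R M] :
    moduleDim R ↥(⊤ : Submodule R M) = moduleDim R M := by
  unfold moduleDim
  rw [(Submodule.topEquiv (R := R) (M := M)).annihilator_eq]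

/-- **Lemma 2.1.** For a good system of parameters `x`, `D_i = (0 :_M x_j)` whenever
`d_i + 1 ≤ j ≤ d_{i+1}` (1-based); in particular the annihilators
`(0 :_M x_1) ⊆ ⋯ ⊆ (0 :_M x_d)` form an increasing chain. -/
theorem stmt_4 {R : Type*} [CommRing R] [IsLocalRing R] [IsNoetherianRing R]
    {M : Type*} [AddCommGroup M] [Module R M] [Module.Finite R M]
    {d t : ℕ} (hd : moduleDim R M = (d : WithBot ℕ∞))
    (D : Fin (t + 1) → Submodule R M) (hD : IsDimFiltration R M D)
    (ds : Fin (t + 1) → ℕ)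
    (hds : ∀ i, (D i = ⊥ ∧ ds i = 0) ∨ moduleDim R ↥(D i) = (ds i : WithBot ℕ∞))
    (x : Fin d → R) (hx : IsGoodSOP R M D ds x) :
    (∀ i : Fin t, ∀ j : Fin d, ds i.castSucc ≤ (j : ℕ) → (j : ℕ) < ds i.succ →
        D i.castSucc = Submodule.torsionBy R M (x j)) ∧
      ∀ j k : Fin d, j ≤ k →
        Submodule.torsionBy R M (x j) ≤ Submodule.torsionBy R M (x k) := by
  obtain ⟨hD0, hDt, hDs⟩ := hD
  obtain ⟨hsop, hgood⟩ := hx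
  -- dimensions of the later members
  have hsucc : ∀ i : Fin t, moduleDim R ↥(D i.succ) = (ds i.succ : WithBot ℕ∞) := by
    intro i
    rcases hds i.succ with ⟨h, _⟩ | h
    · have := (hDs i).2.1
      rw [h, aux_moduleDim_bot] at this
      exact absurd this not_lt_bot
    · exact h
  have hstep : ∀ i : Fin t, ds i.castSucc ≤ ds i.succ := by
    intro i
    rcases hds i.castSucc with ⟨_, h⟩ | h
    · omega
    · have := (hDs i).2.1
      rw [h, hsucc i] at this
      have h' : ds i.castSucc < ds i.succ := by exact_mod_cast this
      exact h'.le
  have hmono : Monotone ds := Fin.monotone_iff_le_succ.mpr hstep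
  have hds0 : ds 0 = 0 := by
    rcases hds 0 with ⟨_, h⟩ | h
    · exact h
    · have h1 := aux_H0m_dim (R := R) (M := M)
      rw [← hD0, h] at h1
      have : ds 0 ≤ 0 := by exact_mod_cast h1
      omega
  have hdst : ds (Fin.last t) = d := by
    rcases hds (Fin.last t) with ⟨h, _⟩ | h
    · rw [← aux_moduleDim_top, ← hDt, h, aux_moduleDim_bot] at hd
      exact absurd hd.symm (WithBot.natCast_ne_bot d)
    · rw [hDt, aux_moduleDim_top, hd] at h
      exact_mod_cast h.symm
  -- the easy inclusion
  have heasy : ∀ i : Fin (t + 1), ∀ k : Fin d, ds i ≤ (k : ℕ) →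
      D i ≤ Submodule.torsionBy R M (x k) := by
    intro i k hik m hm
    have hit : (i : ℕ) < t := by
      by_contra hcon
      have : i = Fin.last t := Fin.ext (by have := i.2; simp; omega)
      rw [this, hdst] at hik
      have := k.2
      omega
    rw [Submodule.mem_torsionBy_iff]
    have : x k • m ∈ D i ⊓ (Ideal.span {r : R | ∃ j : Fin d, ds i ≤ (j : ℕ) ∧ r = x j}) •
        (⊤ : Submodule R M) :=
      ⟨(D i).smul_mem _ hm, Submodule.smul_mem_smul (Ideal.subset_span ⟨k, hik, rfl⟩) trivial⟩
    rw [hgood i hit] at this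
    exact (Submodule.mem_bot R).mp this
  have hfirst : ∀ i : Fin t, ∀ j : Fin d, ds i.castSucc ≤ (j : ℕ) → (j : ℕ) < ds i.succ →
        D i.castSucc = Submodule.torsionBy R M (x j) := by
    intro i j hij hji
    refine le_antisymm (heasy _ j hij) ?_
    have key : ∀ s : Fin (t + 1), i.castSucc ≤ s → Submodule.torsionBy R M (x j) ≤ D s := by
      intro s
      induction s using Fin.reverseInduction with
      | last => intro _; rw [hDt]; exact le_top
      | cast s ih =>
        intro his
        have hle : i.succ ≤ s.succ := Fin.succ_le_succ_iff.mpr (Fin.castSucc_le_castSucc_iff.mp his)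
        have hN := ih (le_trans i.castSucc_lt_succ.le hle)
        apply (hDs s).2.2 _ hN
        rw [hsucc s]
        exact aux_key x hsop _ _ j (lt_of_lt_of_le hji (hmono hle)) le_rfl
          fun k hk => hN.trans (heasy _ k hk)
    exact key _ le_rfl
  refine ⟨hfirst, fun j k hjk => ?_⟩
  have hex : ∃ i : Fin t, ds i.castSucc ≤ (j : ℕ) ∧ (j : ℕ) < ds i.succ := by
    by_contra hcon
    push Not at hcon
    have : ∀ s : Fin (t + 1), ds s ≤ (j : ℕ) := by
      intro s
      induction s using Fin.induction with
      | zero => omega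
      | succ s ih => exact hcon s ih
    have h1 := this (Fin.last t)
    have := j.2
    omega
  obtain ⟨i, hi1, hi2⟩ := hex
  rw [← hfirst i j hi1 hi2]
  exact heasy _ k (hi1.trans (Fin.le_def.mp hjk))
end

section
/- Let (R, 𝔪) be a commutative Noetherian local ring, M a finitely generated R-module, and N a submodule of M such that dim N < dim M and M/N is a Cohen-Macaulay module. If x_1, …, x_i is a part of a system of parameters of M, then (x_1,…,x_i)M ∩ N = (x_1,…,x_i)N. -/
open IsLocalRing

open RingTheory.Sequence Module Pointwise CategoryTheory Abelian in
universe u v in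
lemma aux_depth_quot {R : Type u} [CommRing R] [IsLocalRing R] [IsNoetherianRing R]
    {C : Type v} [AddCommGroup C] [Module R C] [Module.Finite R C] [Nontrivial C]
    (rs : List R) (hm : ∀ r ∈ rs, r ∈ maximalIdeal R) (hr : IsRegular C rs) (n : ℕ)
    (hn : rs.length = n + 1) (x : R) (hxm : x ∈ maximalIdeal R) (hx : IsSMulRegular C x) :
    ∃ ss : List R, (∀ r ∈ ss, r ∈ maximalIdeal R) ∧ IsRegular (QuotSMulTop x C) ss ∧
      ss.length = n := by
  let e : ULift.{u} C ≃ₗ[R] C := ULift.moduleEquiv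
  let D : ModuleCat.{max u v} R := ModuleCat.of R (ULift.{u} C)
  have : Module.Finite R D := inferInstanceAs (Module.Finite R (ULift.{u} C))
  have : Nontrivial D := inferInstanceAs (Nontrivial (ULift.{u} C))
  have hrD : IsRegular D rs := (e.isRegular_congr rs).2 hr
  have hxD : IsSMulRegular D x := (e.isSMulRegular_congr x).2 hx
  have lt_top : ∀ (E : Type (max u v)) [AddCommGroup E] [Module R E] [Module.Finite R E]
      [Nontrivial E], maximalIdeal R • (⊤ : Submodule R E) < ⊤ := fun E _ _ _ _ =>
    (Submodule.top_ne_ideal_smul_of_le_jacobson_annihilator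
      (maximalIdeal_le_jacobson _)).symm.lt_top
  have tf := (ModuleCat.exists_isRegular_tfae (maximalIdeal R) (n + 1) D (lt_top D)).out 3 2
  obtain ⟨N, hN1, hN2, hN3, hN4⟩ := tf.1 ⟨rs, hn, hm, hrD⟩
  have : Nontrivial (QuotSMulTop x D) := nontrivial_quotSMulTop_of_mem_maximalIdeal _ hxm
  have h_ext' : ∀ i < n, Subsingleton (Ext N (ModuleCat.of R (QuotSMulTop x D)) i) := by
    intro i hi
    have zero1 := AddCommGrpCat.isZero_of_iff_subsingleton.mpr (hN4 i (by omega))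
    have zero2 := AddCommGrpCat.isZero_of_iff_subsingleton.mpr (hN4 (i + 1) (by omega))
    exact AddCommGrpCat.subsingleton_of_isZero <| ShortComplex.Exact.isZero_of_both_zeros
      ((Ext.covariant_sequence_exact₃' N hxD.smulShortComplex_shortExact) i (i + 1) rfl)
      (zero1.eq_zero_of_src _) (zero2.eq_zero_of_tgt _)
  obtain ⟨ss, h1, h2, h3⟩ := ModuleCat.exists_isRegular_of_exists_subsingleton_ext
    (maximalIdeal R) n (ModuleCat.of R (QuotSMulTop x D)) (lt_top (QuotSMulTop x D)) N hN3 h_ext'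
  exact ⟨ss, h2, ((QuotSMulTop.congr x e).isRegular_congr ss).1 h3, h1⟩

open Module in
lemma aux_finiteLength {R : Type*} [CommRing R] {C : Type*} [AddCommGroup C] [Module R C]
    (h : IsFiniteLength R C) : ∀ p ∈ support R C, p.asIdeal.IsMaximal := by
  induction h with
  | of_subsingleton => intro p hp; simp [support_eq_empty] at hp
  | @of_simple_quotient M _ _ N _ hN ih =>
    intro p hp
    rw [support_of_exact (LinearMap.exact_subtype_mkQ N) N.subtype_injective
      N.mkQ_surjective] at hp
    rcases hp with hp | hp
    · exact ih p hp
    · rw [mem_support_iff_of_finite] at hp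
      have : (annihilator R (M ⧸ N)).IsMaximal := IsSimpleModule.annihilator_isMaximal
      rwa [← this.eq_of_le p.2.ne_top hp]

open Module in
lemma aux_finiteLength_dim {R : Type*} [CommRing R] {C : Type*} [AddCommGroup C] [Module R C]
    (h : IsFiniteLength R C) : supportDim R C ≤ 0 := by
  refine iSup_le fun s => ?_
  by_contra hs
  have hs : 0 < s.length := by
    by_contra h0
    simp [show s.length = 0 by omega] at hs
  have h1 : s.toFun ⟨0, by omega⟩ < s.toFun ⟨1, by omega⟩ := s.strictMono (Fin.mk_lt_mk.mpr one_pos)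
  have h2 := aux_finiteLength h _ (s.toFun ⟨0, by omega⟩).2
  exact absurd (h2.eq_of_le (s.toFun ⟨1, by omega⟩).1.2.ne_top h1.le)
    (fun h => h1.ne (Subtype.ext (PrimeSpectrum.ext h)))

open Module in
lemma aux_dim_quot {R : Type*} [CommRing R] {M : Type*} [AddCommGroup M] [Module R M]
    (N : Submodule R M) (h : supportDim R N < supportDim R M) :
    supportDim R (M ⧸ N) = supportDim R M := by
  refine le_antisymm (supportDim_le_of_surjective _ N.mkQ_surjective) ?_
  by_contra hlt
  rw [not_le] at hlt
  have key : supportDim R M ≤ max (supportDim R N) (supportDim R (M ⧸ N)) := by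
    refine iSup_le fun s => ?_
    obtain ⟨p, hp⟩ : ∃ p, p = s.head.1 := ⟨_, rfl⟩
    have hs : p ∈ support R M := hp ▸ s.head.2
    rw [support_of_exact (LinearMap.exact_subtype_mkQ N) N.subtype_injective
      N.mkQ_surjective, hp] at hs
    have gen : ∀ T : Set (PrimeSpectrum R), (∀ p q, p ≤ q → p ∈ T → q ∈ T) → s.head.1 ∈ T →
        (s.length : WithBot ℕ∞) ≤ Order.krullDim T := by
      intro T hT h0
      let t : LTSeries T := ⟨s.length, fun i => ⟨(s.toFun i).1,
        hT _ _ (s.monotone (Fin.zero_le i)) h0⟩, fun i => s.step i⟩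
      exact le_iSup (fun p : LTSeries T => (p.length : WithBot ℕ∞)) t
    rcases hs with hs | hs
    · exact (gen _ (fun _ _ h1 h2 => mem_support_mono h1 h2) hs).trans (le_max_left _ _)
    · exact (gen _ (fun _ _ h1 h2 => mem_support_mono h1 h2) hs).trans (le_max_right _ _)
  exact absurd key (not_le.mpr (max_lt h hlt))

open RingTheory.Sequence Module Pointwise in
/-- A nonzero submodule has dimension at least the depth. -/
lemma aux_dim_ge {R : Type*} [CommRing R] [IsLocalRing R] [IsNoetherianRing R]
    (rs : List R) : ∀ {C : Type*} [AddCommGroup C] [Module R C] [Module.Finite R C]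
    (_ : ∀ r ∈ rs, r ∈ maximalIdeal R) (_ : IsWeaklyRegular C rs)
    (L : Submodule R C) (_ : L ≠ ⊥), ((rs.length : ℕ) : WithBot ℕ∞) ≤ supportDim R L := by
  induction rs with
  | nil =>
    intro C _ _ _ _ _ L hL
    have : Nontrivial L := Submodule.nontrivial_iff_ne_bot.mpr hL
    have := supportDim_ne_bot_of_nontrivial R L
    obtain ⟨k, hk⟩ := WithBot.ne_bot_iff_exists.mp this
    rw [← hk]
    simp
  | cons a rs ih =>
    intro C _ _ _ hm hr L hL
    rw [isWeaklyRegular_cons_iff] at hr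
    have ha : a ∈ maximalIdeal R := hm a (by simp)
    -- saturation
    let F : ℕ →o Submodule R C := ⟨fun k => L.comap (LinearMap.lsmul R C (a ^ k)), by
      refine monotone_nat_of_le_succ fun k c hc => ?_
      simp only [Submodule.mem_comap, LinearMap.lsmul_apply] at hc ⊢
      rw [pow_succ', mul_smul]
      exact L.smul_mem _ hc⟩
    obtain ⟨K, hK⟩ := monotone_stabilizes_iff_noetherian.mpr (inferInstance : IsNoetherian R C) F
    let L' := F K
    have hF : ∀ k c, c ∈ F k ↔ a ^ k • c ∈ L := fun k c => by simp [F]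
    have hLL' : L ≤ L' := fun c hc => (hF K c).2 (L.smul_mem _ hc)
    have hL' : L' ≠ ⊥ := fun h => hL (le_bot_iff.mp (h ▸ hLL'))
    have : Nontrivial L' := Submodule.nontrivial_iff_ne_bot.mpr hL'
    have hdim : supportDim R L' ≤ supportDim R L := by
      let f : L' →ₗ[R] L := ((LinearMap.lsmul R C (a ^ K)).comp L'.subtype).codRestrict L
        (fun c => (hF K c.1).1 c.2)
      refine supportDim_le_of_injective f fun u v huv => ?_
      have h1 := congrArg Subtype.val huv
      exact Subtype.ext ((hr.1.pow K) h1)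
    have hregL' : IsSMulRegular L' a := fun u v huv =>
      Subtype.ext (hr.1 (congrArg Subtype.val huv))
    have hsucc := supportDim_quotSMulTop_succ_eq_supportDim hregL' ha
    let g : QuotSMulTop a L' →ₗ[R] QuotSMulTop a C := QuotSMulTop.map a L'.subtype
    have hg : Function.Injective g := by
      rw [← LinearMap.ker_eq_bot, LinearMap.ker_eq_bot']
      intro m hm0
      obtain ⟨u, rfl⟩ := Submodule.mkQ_surjective _ m
      have h2 : (u : C) ∈ a • (⊤ : Submodule R C) := by
        rw [← Submodule.Quotient.mk_eq_zero]
        exact hm0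
      obtain ⟨c, -, hc⟩ := h2
      replace hc : a • c = u := hc
      have hcL : c ∈ L' := by
        have : c ∈ F (K + 1) := by
          rw [hF, pow_succ, mul_smul, hc]
          exact (hF K _).1 u.2
        rwa [← hK (K + 1) (by omega)] at this
      rw [Submodule.mkQ_apply, Submodule.Quotient.mk_eq_zero]
      exact ⟨⟨c, hcL⟩, trivial, Subtype.ext hc⟩
    have : Nontrivial (QuotSMulTop a L') := nontrivial_quotSMulTop_of_mem_maximalIdeal _ ha
    have hrange : LinearMap.range g ≠ ⊥ := by
      rw [← Submodule.nontrivial_iff_ne_bot]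
      exact (LinearEquiv.ofInjective g hg).symm.toEquiv.nontrivial
    have := ih (fun r h => hm r (by simp [h])) hr.2 (LinearMap.range g) hrange
    rw [← supportDim_eq_of_equiv (LinearEquiv.ofInjective g hg)] at this
    refine le_trans ?_ hdim
    rw [← hsucc]
    push_cast [List.length_cons]
    gcongr

open RingTheory.Sequence Module Pointwise in
lemma aux_dim_le_s5 {R : Type*} [CommRing R] [IsLocalRing R] [IsNoetherianRing R]
    (xs : List R) : ∀ {C : Type*} [AddCommGroup C] [Module R C] [Module.Finite R C]
    (_ : ∀ r ∈ xs, r ∈ maximalIdeal R)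
    (_ : supportDim R (C ⧸ (Ideal.ofList xs • ⊤ : Submodule R C)) ≤ 0),
    supportDim R C ≤ ((xs.length : ℕ) : WithBot ℕ∞) := by
  induction xs with
  | nil =>
    intro C _ _ _ hm h
    rw [Ideal.ofList_nil, Submodule.bot_smul,
      supportDim_eq_of_equiv (Submodule.quotEquivOfEqBot ⊥ rfl)] at h
    simpa using h
  | cons x xs ih =>
    intro C _ _ _ hm h
    rw [supportDim_eq_of_equiv (Submodule.quotOfListConsSMulTopEquivQuotSMulTopInner C x xs)] at h
    have h1 := ih (fun r h => hm r (by simp [h])) h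
    refine (supportDim_le_supportDim_quotSMulTop_succ (hm x (by simp))).trans ?_
    push_cast [List.length_cons]
    gcongr

open RingTheory.Sequence Module Pointwise in
lemma aux_main {R : Type*} [CommRing R] [IsLocalRing R] [IsNoetherianRing R]
    (xs : List R) : ∀ {C : Type*} [AddCommGroup C] [Module R C] [Module.Finite R C]
    [Nontrivial C] (_ : ∀ r ∈ xs, r ∈ maximalIdeal R)
    (_ : supportDim R (C ⧸ (Ideal.ofList xs • ⊤ : Submodule R C)) ≤ 0)
    (rs : List R) (_ : ∀ r ∈ rs, r ∈ maximalIdeal R) (_ : IsRegular C rs)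
    (_ : rs.length = xs.length), IsWeaklyRegular C xs := by
  induction xs with
  | nil => intros; simp
  | cons x xs ih =>
    intro C _ _ _ _ hm h rs hrm hr hlen
    have hxm := hm x (by simp)
    rw [supportDim_eq_of_equiv (Submodule.quotOfListConsSMulTopEquivQuotSMulTopInner C x xs)] at h
    have h1 := aux_dim_le_s5 xs (fun r h => hm r (by simp [h])) h
    have hx : IsSMulRegular C x := by
      by_contra hx
      have hL : Submodule.torsionBy R C x ≠ ⊥ := fun h0 =>
        hx ((isSMulRegular_iff_torsionBy_eq_bot C x).2 h0)
      have h2 := aux_dim_ge rs hrm hr.toIsWeaklyRegular _ hL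
      have h3 : supportDim R (Submodule.torsionBy R C x) ≤ supportDim R (QuotSMulTop x C) := by
        have hsub : support R (Submodule.torsionBy R C x) ⊆ support R (QuotSMulTop x C) := by
          rw [support_quotSMulTop]
          refine Set.subset_inter
            (support_subset_of_injective _ (Submodule.subtype_injective _)) ?_
          intro p hp
          rw [mem_support_iff_of_finite] at hp
          simp only [PrimeSpectrum.mem_zeroLocus, Set.singleton_subset_iff]
          refine hp ?_
          rw [mem_annihilator]
          rintro ⟨c, hc⟩
          exact Subtype.ext ((Submodule.mem_torsionBy_iff x c).1 hc)
        exact Order.krullDim_le_of_strictMono (Set.inclusion hsub) (fun _ _ h => h)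
      have h4 := (h2.trans h3).trans h1
      rw [hlen] at h4
      have : (x :: xs).length ≤ xs.length := by exact_mod_cast h4
      simp at this
    obtain ⟨ss, hsm, hs, hsl⟩ := aux_depth_quot rs hrm hr xs.length (by simpa using hlen) x hxm hx
    have : Nontrivial (QuotSMulTop x C) := nontrivial_quotSMulTop_of_mem_maximalIdeal _ hxm
    exact .cons hx (ih (fun r h => hm r (by simp [h])) h ss hsm hs hsl)

open RingTheory.Sequence in
lemma aux_inter {R : Type*} [CommRing R] {M : Type*} [AddCommGroup M] [Module R M]
    (N : Submodule R M) (xs : List R) (h : IsWeaklyRegular (M ⧸ N) xs) :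
    (Ideal.ofList xs • (⊤ : Submodule R M)) ⊓ N = Ideal.ofList xs • N := by
  apply le_antisymm
  · rintro m ⟨hm, hmN⟩
    have hex : Function.Exact (0 : PUnit →ₗ[R] N) N.subtype := by
      intro y
      simp
      exact eq_comm
    have key := map_first_exact_on_four_term_right_exact_of_isSMulRegular_last
      hex (LinearMap.exact_subtype_mkQ N) N.mkQ_surjective h
    have h1 := (key (Submodule.Quotient.mk ⟨m, hmN⟩)).1 (by
      rw [Submodule.mapQ_apply, Submodule.Quotient.mk_eq_zero]
      exact hm)
    obtain ⟨z, hz⟩ := h1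
    obtain ⟨z, rfl⟩ := Submodule.mkQ_surjective _ z
    have h2 : (⟨m, hmN⟩ : N) ∈ (Ideal.ofList xs • (⊤ : Submodule R N)) := by
      rw [← Submodule.Quotient.mk_eq_zero, ← hz]
      simp
    have h3 := Submodule.mem_map_of_mem (f := N.subtype) h2
    rwa [Submodule.map_smul'', Submodule.map_top, Submodule.range_subtype] at h3
  · exact le_inf (Submodule.smul_mono le_rfl le_top) Submodule.smul_le_right

/-- **Lemma 2.2.** If `N ⊆ M` with `dim N < dim M` and `M/N` Cohen-Macaulay, then for a
part `x₁,…,x_i` of a system of parameters of `M`, `(x₁,…,x_i)M ∩ N = (x₁,…,x_i)N`. -/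
theorem stmt_5 {R : Type*} [CommRing R] [IsLocalRing R] [IsNoetherianRing R]
    {M : Type*} [AddCommGroup M] [Module R M] [Module.Finite R M]
    (N : Submodule R M) (hdim : moduleDim R ↥N < moduleDim R M)
    (hCM : IsCM R (M ⧸ N))
    {d : ℕ} (hd : moduleDim R M = (d : WithBot ℕ∞))
    (x : Fin d → R) (hx : IsSOP R M x) (i : ℕ) (hi : i ≤ d) :
    (Ideal.span {r : R | ∃ j : Fin d, (j : ℕ) < i ∧ r = x j} • (⊤ : Submodule R M)) ⊓ N =
      Ideal.span {r : R | ∃ j : Fin d, (j : ℕ) < i ∧ r = x j} • N := by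
  have eqd : ∀ (P : Type _) [AddCommGroup P] [Module R P] [Module.Finite R P],
      moduleDim R P = Module.supportDim R P := fun P _ _ _ =>
    (Module.supportDim_eq_ringKrullDim_quotient_annihilator R P).symm
  have hq : Module.supportDim R (M ⧸ N) = d := by
    rw [eqd, eqd] at hdim
    rw [aux_dim_quot N hdim, ← eqd, hd]
  have hnt : Nontrivial (M ⧸ N) := by
    rw [← Module.supportDim_ne_bot_iff_nontrivial R, hq]
    exact WithBot.coe_ne_bot
  have hdep : moduleDepth R (M ⧸ N) = (d : ℕ∞) := by
    have h1 : (moduleDepth R (M ⧸ N) : WithBot ℕ∞) = _ := hCM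
    rw [eqd, hq] at h1
    exact_mod_cast h1
  have hmem : ∃ rs : List R, (rs.length : ℕ∞) = (d : ℕ∞) ∧ (∀ r ∈ rs, r ∈ maximalIdeal R) ∧
      RingTheory.Sequence.IsRegular (M ⧸ N) rs := by
    have hne : Nonempty {n : ℕ∞ | ∃ rs : List R, (rs.length : ℕ∞) = n ∧
        (∀ r ∈ rs, r ∈ maximalIdeal R) ∧ RingTheory.Sequence.IsRegular (M ⧸ N) rs} :=
      ⟨⟨0, [], by simp, by simp, RingTheory.Sequence.IsRegular.nil R _⟩⟩
    have h2 := ENat.sSup_mem_of_nonempty_of_lt_top (hdep.trans_lt (ENat.natCast_lt_top d))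
    exact (congrArg (· ∈ _) hdep).mp h2
  obtain ⟨rs, hlen, hrm, hreg⟩ := hmem
  have hlen : rs.length = d := by exact_mod_cast hlen
  have hof : Ideal.ofList (List.ofFn x) = Ideal.span (Set.range x) := by
    unfold Ideal.ofList
    congr 1
    ext r
    simp [List.mem_ofFn]
  have hfl : Module.supportDim R
      ((M ⧸ N) ⧸ (Ideal.ofList (List.ofFn x) • ⊤ : Submodule R (M ⧸ N))) ≤ 0 := by
    rw [hof]
    refine aux_finiteLength_dim (hx.2.of_surjective
      (f := Submodule.mapQ _ _ N.mkQ (Submodule.smul_top_le_comap_smul_top _ _)) ?_)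
    rintro y
    obtain ⟨y, rfl⟩ := Submodule.mkQ_surjective _ y
    obtain ⟨y, rfl⟩ := Submodule.mkQ_surjective _ y
    exact ⟨Submodule.Quotient.mk y, rfl⟩
  have hw := aux_main (C := M ⧸ N) (List.ofFn x)
    (by intro r hr; obtain ⟨j, rfl⟩ := (List.mem_ofFn' _ _).1 hr; exact hx.1 j)
    hfl rs hrm hreg (by simpa using hlen)
  rw [← List.take_append_drop i (List.ofFn x),
    RingTheory.Sequence.isWeaklyRegular_append_iff] at hw
  have hset : Ideal.span {r : R | ∃ j : Fin d, (j : ℕ) < i ∧ r = x j} =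
      Ideal.ofList ((List.ofFn x).take i) := by
    unfold Ideal.ofList
    congr 1
    ext r
    simp only [Set.mem_setOf_eq, List.mem_take_iff_getElem, List.getElem_ofFn, List.length_ofFn]
    constructor
    · rintro ⟨j, hj, rfl⟩
      exact ⟨j, by omega, rfl⟩
    · rintro ⟨j, hj, rfl⟩
      exact ⟨⟨j, by omega⟩, by simp; omega, rfl⟩
  rw [hset]
  exact aux_inter N _ hw.1
end
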